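/- arXiv:2108.07710 — 4 statements merged into one kernel-verified Lean document; each statement's English description precedes it below -/
import Mathlib

section
/- For bounded complex random variables X, Y, X₁, …, Xₙ on a probability space, the joint cumulant satisfies the product formula M(XY, X₁, …, Xₙ) = M(X, Y, X₁, …, Xₙ) + ∑_{I ⊆ {1,…,n}} M(X; X_I) · M(Y; X_{I^c}), where the sum is over all subsets I of {1,…,n}, X_I denotes the family (X_i)_{i∈I}, and I^c = {1,…,n} \ I. -/
open MeasureTheory Finset

noncomputable section

open scoped Classical in
/-- The collection of set partitions of a finite set `J`. -/
def partitionsOf {ι : Type*} (J : Finset ι) : Finset (Finset (Finset ι)) :=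
  J.powerset.powerset.filter
    (fun P => (∀ b ∈ P, b.Nonempty) ∧ ∀ x ∈ J, ∃! b, b ∈ P ∧ x ∈ b)

/-- The joint cumulant `M(X_J)` via the Möbius (moment–cumulant) formula. -/
def jointCumulant {Ω : Type*} [MeasurableSpace Ω] (μ : Measure Ω)
    {ι : Type*} (X : ι → Ω → ℂ) (J : Finset ι) : ℂ :=
  ∑ P ∈ partitionsOf J,
    (-1 : ℂ) ^ (P.card - 1) * ((P.card - 1).factorial : ℂ) *
      ∏ b ∈ P, ∫ ω, (∏ j ∈ b, X j ω) ∂μ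

/-- The joint cumulant `M(X₁, …, Xₙ)` of a tuple of complex random variables. -/
def cumulant {Ω : Type*} [MeasurableSpace Ω] (μ : Measure Ω)
    {n : ℕ} (X : Fin n → Ω → ℂ) : ℂ :=
  jointCumulant μ X Finset.univ

/-- Sign and factorial weight. -/
def kapCoef (k : ℕ) : ℂ := (-1 : ℂ) ^ (k - 1) * ((k - 1).factorial : ℂ)

/-- Cumulant of an abstract moment functional. -/
def kap {ι : Type*} (m : Finset ι → ℂ) (J : Finset ι) : ℂ :=
  ∑ P ∈ partitionsOf J, kapCoef P.card * ∏ b ∈ P, m b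

theorem mem_partitionsOf {ι : Type*} {J : Finset ι} {P : Finset (Finset ι)} :
    P ∈ partitionsOf J ↔ (∀ b ∈ P, b ⊆ J) ∧ (∀ b ∈ P, b.Nonempty) ∧
      ∀ x ∈ J, ∃! b, b ∈ P ∧ x ∈ b := by
  classical
  simp only [partitionsOf, Finset.mem_filter, Finset.mem_powerset, Finset.subset_iff]

theorem part_disj {ι : Type*} {J : Finset ι} {P : Finset (Finset ι)} (h : P ∈ partitionsOf J)
    {b c : Finset ι} (hb : b ∈ P) (hc : c ∈ P) {x : ι} (hxb : x ∈ b) (hxc : x ∈ c) : b = c := by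
  rw [mem_partitionsOf] at h
  exact (h.2.2 x (h.1 b hb hxb)).unique ⟨hb, hxb⟩ ⟨hc, hxc⟩

theorem kapCoef_rec (k : ℕ) (hk : 1 ≤ k) :
    kapCoef k + ((k - 1 : ℕ) : ℂ) * kapCoef (k - 1) = if k = 1 then 1 else 0 := by
  obtain ⟨j, rfl⟩ : ∃ j, k = j + 1 := ⟨k - 1, by omega⟩
  rcases j with _ | j
  · simp [kapCoef]
  · simp [kapCoef, Nat.factorial_succ, pow_succ]
    ring

open scoped Classical in
theorem kap_bij {ι : Type*} (m : Finset ι → ℂ) (J : Finset ι) (a : ι) (ha : a ∈ J) :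
    ∑ B ∈ J.powerset.filter (fun B => a ∈ B ∧ B ≠ J), kap m B * m (J \ B) =
      ∑ Q ∈ partitionsOf J, ∑ b ∈ Q.filter (fun b => a ∉ b),
        kapCoef (Q.card - 1) * ∏ b ∈ Q, m b := by
  simp only [kap, Finset.sum_mul]
  rw [Finset.sum_sigma', Finset.sum_sigma']
  have key : ∀ (B : Finset ι) (P : Finset (Finset ι)), B ⊆ J → P ∈ partitionsOf B →
      J \ B ∉ P := by
    intro B P hB hP hmem
    rw [mem_partitionsOf] at hP
    obtain ⟨x, hx⟩ := hP.2.1 _ hmem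
    exact (Finset.mem_sdiff.1 hx).2 (hP.1 _ hmem hx)
  refine Finset.sum_bij' (fun p _ => ⟨insert (J \ p.1) p.2, J \ p.1⟩)
    (fun q _ => ⟨J \ q.2, q.1.erase q.2⟩) ?_ ?_ ?_ ?_ ?_
  · rintro ⟨B, P⟩ h
    simp only [Finset.mem_sigma, Finset.mem_filter, Finset.mem_powerset] at h ⊢
    obtain ⟨⟨hBJ, haB, hne⟩, hP⟩ := h
    refine ⟨?_, Finset.mem_insert_self _ _, by simp [haB]⟩
    rw [mem_partitionsOf] at hP ⊢
    obtain ⟨h1, h2, h3⟩ := hP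
    refine ⟨?_, ?_, ?_⟩
    · intro b hb
      rcases Finset.mem_insert.1 hb with rfl | hb
      · exact Finset.sdiff_subset
      · exact (h1 b hb).trans hBJ
    · intro b hb
      rcases Finset.mem_insert.1 hb with rfl | hb
      · rw [Finset.sdiff_nonempty]
        exact fun h => hne (hBJ.antisymm h)
      · exact h2 b hb
    · intro x hx
      by_cases hxB : x ∈ B
      · obtain ⟨b, ⟨hb, hxb⟩, hu⟩ := h3 x hxB
        refine ⟨b, ⟨Finset.mem_insert_of_mem hb, hxb⟩, ?_⟩
        rintro c ⟨hc, hxc⟩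
        rcases Finset.mem_insert.1 hc with rfl | hc
        · exact absurd hxB (Finset.mem_sdiff.1 hxc).2
        · exact hu c ⟨hc, hxc⟩
      · refine ⟨J \ B, ⟨Finset.mem_insert_self _ _, Finset.mem_sdiff.2 ⟨hx, hxB⟩⟩, ?_⟩
        rintro c ⟨hc, hxc⟩
        rcases Finset.mem_insert.1 hc with rfl | hc
        · rfl
        · exact absurd (h1 c hc hxc) hxB
  · rintro ⟨Q, b⟩ h
    simp only [Finset.mem_sigma, Finset.mem_filter, Finset.mem_powerset] at h ⊢
    obtain ⟨hQ, hb, hab⟩ := h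
    have hQ' := hQ
    rw [mem_partitionsOf] at hQ'
    obtain ⟨h1, h2, h3⟩ := hQ'
    refine ⟨⟨Finset.sdiff_subset, Finset.mem_sdiff.2 ⟨ha, hab⟩, ?_⟩, ?_⟩
    · intro h
      obtain ⟨x, hx⟩ := h2 b hb
      have := h1 b hb hx
      rw [← h] at this
      exact (Finset.mem_sdiff.1 this).2 hx
    · rw [mem_partitionsOf]
      refine ⟨?_, ?_, ?_⟩
      · intro c hc x hx
        rw [Finset.mem_erase] at hc
        refine Finset.mem_sdiff.2 ⟨h1 c hc.2 hx, fun hxb => hc.1 (part_disj hQ hc.2 hb hx hxb)⟩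
      · intro c hc
        exact h2 c (Finset.mem_of_mem_erase hc)
      · intro x hx
        rw [Finset.mem_sdiff] at hx
        obtain ⟨c, ⟨hc, hxc⟩, hu⟩ := h3 x hx.1
        refine ⟨c, ⟨Finset.mem_erase.2 ⟨?_, hc⟩, hxc⟩, ?_⟩
        · rintro rfl
          exact hx.2 hxc
        · rintro d ⟨hd, hxd⟩
          exact hu d ⟨Finset.mem_of_mem_erase hd, hxd⟩
  · rintro ⟨B, P⟩ h
    simp only [Finset.mem_sigma, Finset.mem_filter, Finset.mem_powerset] at h
    have := key B P h.1.1 h.2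
    simp only [Finset.erase_insert this, Finset.sdiff_sdiff_eq_self h.1.1]
  · rintro ⟨Q, b⟩ h
    simp only [Finset.mem_sigma, Finset.mem_filter] at h
    have hbJ := (mem_partitionsOf.1 h.1).1 b h.2.1
    simp only [Finset.sdiff_sdiff_eq_self hbJ, Finset.insert_erase h.2.1]
  · rintro ⟨B, P⟩ h
    simp only [Finset.mem_sigma, Finset.mem_filter, Finset.mem_powerset] at h
    have := key B P h.1.1 h.2
    simp only [Finset.card_insert_of_notMem this, Finset.prod_insert this,
      Nat.add_sub_cancel]
    ring

open scoped Classical in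
theorem part_card {ι : Type*} {J : Finset ι} {a : ι} (ha : a ∈ J) {Q : Finset (Finset ι)}
    (hQ : Q ∈ partitionsOf J) :
    1 ≤ Q.card ∧ (Q.filter (fun b => a ∉ b)).card = Q.card - 1 := by
  obtain ⟨c, ⟨hc, hac⟩, hu⟩ := (mem_partitionsOf.1 hQ).2.2 a ha
  refine ⟨Finset.card_pos.2 ⟨c, hc⟩, ?_⟩
  rw [← Finset.card_erase_of_mem hc]
  congr 1
  ext b
  simp only [Finset.mem_filter, Finset.mem_erase]
  constructor
  · rintro ⟨hb, hab⟩
    exact ⟨fun h => hab (h ▸ hac), hb⟩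
  · rintro ⟨hne, hb⟩
    exact ⟨hb, fun hab => hne (hu b ⟨hb, hab⟩)⟩

open scoped Classical in
theorem kap_rec {ι : Type*} (m : Finset ι → ℂ) (hm : m ∅ = 1) (J : Finset ι) (a : ι)
    (ha : a ∈ J) :
    ∑ B ∈ J.powerset.filter (fun B => a ∈ B), kap m B * m (J \ B) = m J := by
  have hJ : J ∈ J.powerset.filter (fun B => a ∈ B) := by simp [ha]
  rw [← Finset.add_sum_erase _ _ hJ]
  have h1 : (J.powerset.filter (fun B => a ∈ B)).erase J =
      J.powerset.filter (fun B => a ∈ B ∧ B ≠ J) := by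
    ext B
    simp only [Finset.mem_erase, Finset.mem_filter]
    tauto
  rw [h1, kap_bij m J a ha, Finset.sdiff_self, hm, mul_one, kap, ← Finset.sum_add_distrib]
  have h2 : ∀ Q ∈ partitionsOf J, (kapCoef Q.card * ∏ b ∈ Q, m b +
      ∑ b ∈ Q.filter (fun b => a ∉ b), kapCoef (Q.card - 1) * ∏ b ∈ Q, m b) =
      if Q = {J} then m J else 0 := by
    intro Q hQ
    obtain ⟨hc, hf⟩ := part_card ha hQ
    rw [Finset.sum_const, hf, nsmul_eq_mul, ← mul_assoc, ← add_mul, kapCoef_rec _ hc]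
    by_cases hQ1 : Q.card = 1
    · obtain ⟨c, rfl⟩ := Finset.card_eq_one.1 hQ1
      have hQ' := mem_partitionsOf.1 hQ
      have : c = J := by
        apply (hQ'.1 c (by simp)).antisymm
        intro x hx
        obtain ⟨d, ⟨hd, hxd⟩, _⟩ := hQ'.2.2 x hx
        rw [Finset.mem_singleton] at hd
        exact hd ▸ hxd
      subst this
      simp
    · have : Q ≠ {J} := by
        rintro rfl
        simp at hQ1
      simp [hQ1, this]
  rw [Finset.sum_congr rfl h2, Finset.sum_ite_eq', if_pos]
  rw [mem_partitionsOf]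
  refine ⟨by simp, by simpa using ⟨a, ha⟩, ?_⟩
  intro x hx
  exact ⟨J, ⟨by simp, hx⟩, by simp⟩

open scoped Classical in
theorem kap_rec_insert {ι : Type*} (m : Finset ι → ℂ) (hm : m ∅ = 1) (T : Finset ι) (a : ι)
    (ha : a ∉ T) :
    ∑ B ∈ T.powerset, kap m (insert a B) * m (T \ B) = m (insert a T) := by
  rw [← kap_rec m hm (insert a T) a (Finset.mem_insert_self _ _), Finset.sum_filter,
    Finset.sum_powerset_insert ha]
  have h1 : ∀ B ∈ T.powerset, (if a ∈ B then kap m B * m (insert a T \ B) else 0) = 0 := by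
    intro B hB
    rw [if_neg fun h => ha (Finset.mem_powerset.1 hB h)]
  rw [Finset.sum_congr rfl h1, Finset.sum_const_zero, zero_add]
  refine Finset.sum_congr rfl fun B hB => ?_
  rw [if_pos (Finset.mem_insert_self _ _)]
  congr 2
  ext x
  simp only [Finset.mem_sdiff, Finset.mem_insert]
  constructor
  · rintro ⟨hx, hB⟩
    exact ⟨Or.inr hx, fun h => h.elim (fun h => ha (h ▸ hx)) hB⟩
  · rintro ⟨hx, hB⟩
    exact ⟨hx.resolve_left fun h => hB (Or.inl h), fun h => hB (Or.inr h)⟩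

theorem sum_powerset_map {α β : Type*} (e : α ↪ β) (S : Finset α) (f : Finset β → ℂ) :
    ∑ B ∈ (S.map e).powerset, f B = ∑ B ∈ S.powerset, f (B.map e) := by
  classical
  symm
  refine Finset.sum_bij (fun B _ => B.map e) ?_ ?_ ?_ ?_
  · intro B hB
    exact Finset.mem_powerset.2 (Finset.map_subset_map.2 (Finset.mem_powerset.1 hB))
  · intro B _ C _ h
    exact Finset.map_injective e h
  · intro B hB
    obtain ⟨u, hu, rfl⟩ := Finset.subset_map_iff.1 (Finset.mem_powerset.1 hB)
    exact ⟨u, Finset.mem_powerset.2 hu, rfl⟩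
  · intro _ _
    rfl

theorem conv_unique {α : Type*} [DecidableEq α] (m A A' : Finset α → ℂ) (hm : m ∅ = 1)
    (h : ∀ S, ∑ B ∈ S.powerset, A B * m (S \ B) = ∑ B ∈ S.powerset, A' B * m (S \ B)) :
    ∀ S, A S = A' S := by
  intro S
  induction S using Finset.strongInduction with
  | H S ih =>
    have := h S
    have hS : S ∈ S.powerset := by simp
    rw [← Finset.add_sum_erase _ _ hS, ← Finset.add_sum_erase _ _ hS, Finset.sdiff_self, hm,
      mul_one, mul_one] at this
    rw [Finset.sum_congr rfl (g := fun B => A' B * m (S \ B))] at this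
    · exact add_right_cancel this
    · intro B hB
      rw [Finset.mem_erase, Finset.mem_powerset] at hB
      rw [ih B (Finset.ssubset_iff_subset_ne.2 ⟨hB.2, hB.1⟩)]

theorem conv_assoc {α : Type*} [DecidableEq α] (f g m : Finset α → ℂ) (S : Finset α) :
    ∑ B ∈ S.powerset, f B * ∑ C ∈ (S \ B).powerset, g C * m ((S \ B) \ C) =
      ∑ B ∈ S.powerset, (∑ I ∈ B.powerset, f I * g (B \ I)) * m (S \ B) := by
  simp only [Finset.mul_sum, Finset.sum_mul]
  rw [Finset.sum_sigma', Finset.sum_sigma']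
  refine Finset.sum_bij' (fun p _ => ⟨p.1 ∪ p.2, p.1⟩) (fun q _ => ⟨q.2, q.1 \ q.2⟩)
    ?_ ?_ ?_ ?_ ?_
  · rintro ⟨B, C⟩ h
    simp only [Finset.mem_sigma, Finset.mem_powerset] at h ⊢
    exact ⟨Finset.union_subset h.1 (h.2.trans Finset.sdiff_subset), Finset.subset_union_left⟩
  · rintro ⟨B, I⟩ h
    simp only [Finset.mem_sigma, Finset.mem_powerset] at h ⊢
    exact ⟨h.2.trans h.1, Finset.sdiff_subset_sdiff h.1 le_rfl⟩
  · rintro ⟨B, C⟩ h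
    simp only [Finset.mem_sigma, Finset.mem_powerset, Finset.subset_sdiff] at h
    have : (B ∪ C) \ B = C := Finset.union_sdiff_cancel_left h.2.2.symm
    simp only [this]
  · rintro ⟨B, I⟩ h
    simp only [Finset.mem_sigma, Finset.mem_powerset] at h
    simp only [Finset.union_sdiff_of_subset h.2]
  · rintro ⟨B, C⟩ h
    simp only [Finset.mem_sigma, Finset.mem_powerset, Finset.subset_sdiff] at h
    have : (B ∪ C) \ B = C := Finset.union_sdiff_cancel_left h.2.2.symm
    simp only [this, sdiff_sdiff_left, mul_assoc]
    rfl

/-- Moment functional. -/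
def mom {Ω : Type*} [MeasurableSpace Ω] (μ : Measure Ω)
    {ι : Type*} (X : ι → Ω → ℂ) (b : Finset ι) : ℂ := ∫ ω, (∏ j ∈ b, X j ω) ∂μ

theorem mom_empty {Ω : Type*} [MeasurableSpace Ω] (μ : Measure Ω) [IsProbabilityMeasure μ]
    {ι : Type*} (X : ι → Ω → ℂ) : mom μ X ∅ = 1 := by
  simp [mom]

theorem jc_eq {Ω : Type*} [MeasurableSpace Ω] (μ : Measure Ω)
    {ι : Type*} (X : ι → Ω → ℂ) (J : Finset ι) : jointCumulant μ X J = kap (mom μ X) J := rfl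

/-- Recursion for cumulants of `Z a` together with a subfamily of `Z ∘ e`. -/
theorem jc_rec {Ω : Type*} [MeasurableSpace Ω] (μ : Measure Ω) [IsProbabilityMeasure μ]
    {ι α : Type*} [DecidableEq ι] [DecidableEq α] (Z : ι → Ω → ℂ) (W : α → Ω → ℂ) (e : α ↪ ι)
    (hW : ∀ i, Z (e i) = W i) (a : ι) (ha : ∀ i, e i ≠ a) (S : Finset α) :
    ∑ B ∈ S.powerset, jointCumulant μ Z (insert a (B.map e)) * mom μ W (S \ B) =
      ∫ ω, Z a ω * ∏ j ∈ S, W j ω ∂μ := by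
  have haS : ∀ S : Finset α, a ∉ S.map e := by
    intro S h
    obtain ⟨i, _, hi⟩ := Finset.mem_map.1 h
    exact ha i hi
  have := kap_rec_insert (mom μ Z) (mom_empty μ Z) (S.map e) a (haS S)
  rw [sum_powerset_map] at this
  have h2 : mom μ Z (insert a (S.map e)) = ∫ ω, Z a ω * ∏ j ∈ S, W j ω ∂μ := by
    simp only [mom]
    congr 1
    ext ω
    convert Finset.prod_insert (f := fun j => Z j ω) (haS S) using 2
    simp [Finset.prod_map, hW]
  rw [← h2]
  convert this using 1
  swap
  · congr!
  refine Finset.sum_congr rfl fun B hB => ?_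
  rw [jc_eq]
  have h3 : S.map e \ B.map e = (S \ B).map e := by
    ext x
    simp only [Finset.mem_sdiff, Finset.mem_map]
    constructor
    · rintro ⟨⟨i, hi, rfl⟩, h⟩
      exact ⟨i, ⟨hi, fun hB => h ⟨i, hB, rfl⟩⟩, rfl⟩
    · rintro ⟨i, ⟨hi, hB⟩, rfl⟩
      refine ⟨⟨i, hi, rfl⟩, ?_⟩
      rintro ⟨j, hj, h⟩
      exact hB (e.injective h ▸ hj)
  have h4 : mom μ Z (S.map e \ B.map e) = mom μ W (S \ B) := by
    rw [h3]
    simp [mom, Finset.prod_map, hW]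
  rw [← h4]
  congr!

/-- Recursion for cumulants of `Z a`, `Z c` together with a subfamily of `Z ∘ e`. -/
theorem jc_rec_two {Ω : Type*} [MeasurableSpace Ω] (μ : Measure Ω) [IsProbabilityMeasure μ]
    {ι α : Type*} [DecidableEq ι] [DecidableEq α] (Z : ι → Ω → ℂ) (W : α → Ω → ℂ) (e : α ↪ ι)
    (hW : ∀ i, Z (e i) = W i) (a c : ι) (hac : a ≠ c) (ha : ∀ i, e i ≠ a) (hc : ∀ i, e i ≠ c)
    (S : Finset α) :
    ∑ B ∈ S.powerset, jointCumulant μ Z (insert a (B.map e)) *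
        (∫ ω, Z c ω * ∏ j ∈ S \ B, W j ω ∂μ) +
      ∑ B ∈ S.powerset, jointCumulant μ Z (insert a (insert c (B.map e))) * mom μ W (S \ B) =
      ∫ ω, Z a ω * (Z c ω * ∏ j ∈ S, W j ω) ∂μ := by
  -- use the option embedding
  let e' : Option α ↪ ι := ⟨fun o => o.elim c e, by
    rintro (_ | i) (_ | j) h
    · rfl
    · exact absurd h.symm (hc j)
    · exact absurd h (hc i)
    · exact congrArg some (e.injective h)⟩
  let W' : Option α → Ω → ℂ := fun o => o.elim (Z c) W
  have hn : ∀ S : Finset α, (none : Option α) ∉ S.map Function.Embedding.some := by simp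
  have key := jc_rec μ Z W' e' (by rintro (_ | i); exacts [rfl, hW i]) a
    (by rintro (_ | i); exacts [hac.symm, ha i])
    (insert none (S.map Function.Embedding.some))
  rw [Finset.sum_powerset_insert (hn S), sum_powerset_map, sum_powerset_map] at key
  have hmm : ∀ B : Finset α, (B.map Function.Embedding.some).map e' = B.map e := by
    intro B
    rw [Finset.map_map]
    rfl
  have hd1 : ∀ B : Finset α, insert none (S.map Function.Embedding.some) \
      B.map Function.Embedding.some = insert none ((S \ B).map Function.Embedding.some) := by
    intro B
    ext (_ | x) <;> simp
  have hd2 : ∀ B : Finset α, insert none (S.map Function.Embedding.some) \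
      insert none (B.map Function.Embedding.some) = (S \ B).map Function.Embedding.some := by
    intro B
    ext (_ | x) <;> simp
  have hp : ∀ (B : Finset α) ω, ∏ j ∈ insert none (B.map Function.Embedding.some), W' j ω =
      Z c ω * ∏ j ∈ B, W j ω := by
    intro B ω
    rw [Finset.prod_insert (hn B), Finset.prod_map]
    rfl
  have hq : ∀ B : Finset α, mom μ W' (B.map Function.Embedding.some) = mom μ W B := by
    intro B
    simp only [mom, Finset.prod_map]
    rfl
  have he : e' none = c := rfl
  simp only [hd1, hd2, hq, Finset.map_insert, hmm, he, hp] at key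
  simpa only [mom, hp] using key

/-- Malyshev's product formula for joint cumulants:
`M(XY, X₁,…,Xₙ) = M(X,Y,X₁,…,Xₙ) + ∑_{I ⊆ {1,…,n}} M(X; X_I) · M(Y; X_{Iᶜ})`. -/
theorem cumulant_product_formula {Ω : Type*} [MeasurableSpace Ω]
    (μ : Measure Ω) [IsProbabilityMeasure μ] {n : ℕ}
    (X Y : Ω → ℂ) (Xs : Fin n → Ω → ℂ)
    (hX : Measurable X) (hY : Measurable Y) (hXs : ∀ i, Measurable (Xs i))
    (hXb : ∃ C : ℝ, ∀ ω, ‖X ω‖ ≤ C) (hYb : ∃ C : ℝ, ∀ ω, ‖Y ω‖ ≤ C)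
    (hXsb : ∀ i, ∃ C : ℝ, ∀ ω, ‖Xs i ω‖ ≤ C) :
    cumulant μ (Fin.cons (fun ω => X ω * Y ω) Xs) =
      cumulant μ (Fin.cons X (Fin.cons Y Xs)) +
        ∑ I ∈ (Finset.univ : Finset (Fin n)).powerset,
          jointCumulant μ (Fin.cons X Xs)
              (insert 0 (I.map ⟨Fin.succ, Fin.succ_injective n⟩)) *
            jointCumulant μ (Fin.cons Y Xs)
              (insert 0 ((Finset.univ \ I).map ⟨Fin.succ, Fin.succ_injective n⟩)) := by
  classical
  have hs : ∀ i : Fin n, (⟨Fin.succ, Fin.succ_injective n⟩ : Fin n ↪ Fin (n+1)) i ≠ 0 :=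
    fun i => Fin.succ_ne_zero i
  let e1 : Fin n ↪ Fin (n+1) := ⟨Fin.succ, Fin.succ_injective n⟩
  let e2 : Fin n ↪ Fin (n+2) := e1.trans ⟨Fin.succ, Fin.succ_injective (n+1)⟩
  have hXY := jc_rec μ (Fin.cons (fun ω => X ω * Y ω) Xs : Fin (n+1) → Ω → ℂ) Xs e1
    (fun i => rfl) 0 hs
  have hX1 := jc_rec μ (Fin.cons X Xs : Fin (n+1) → Ω → ℂ) Xs e1 (fun i => rfl) 0 hs
  have hY1 := jc_rec μ (Fin.cons Y Xs : Fin (n+1) → Ω → ℂ) Xs e1 (fun i => rfl) 0 hs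
  have h20 : ∀ i, e2 i ≠ 0 := fun i => Fin.succ_ne_zero (e1 i)
  have h21 : ∀ i, e2 i ≠ 1 := fun i h => Fin.succ_ne_zero i (Fin.succ_injective _ h)
  have hX2 := jc_rec μ (Fin.cons X (Fin.cons Y Xs : Fin (n+1) → Ω → ℂ) : Fin (n+2) → Ω → ℂ)
    Xs e2 (fun i => rfl) 0 h20
  have h2 := jc_rec_two μ (Fin.cons X (Fin.cons Y Xs : Fin (n+1) → Ω → ℂ) : Fin (n+2) → Ω → ℂ)
    Xs e2 (fun i => rfl) 0 1 (by simp) h20 h21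
  have hXX := conv_unique (mom μ Xs) _ _ (mom_empty μ Xs)
    (fun S => (hX2 S).trans (hX1 S).symm)
  have main := conv_unique (mom μ Xs)
    (fun S => jointCumulant μ (Fin.cons (fun ω => X ω * Y ω) Xs : Fin (n+1) → Ω → ℂ)
      (insert 0 (S.map e1)))
    (fun S => jointCumulant μ
        (Fin.cons X (Fin.cons Y Xs : Fin (n+1) → Ω → ℂ) : Fin (n+2) → Ω → ℂ)
        (insert 0 (insert 1 (S.map e2))) +
      ∑ I ∈ S.powerset, jointCumulant μ (Fin.cons X Xs : Fin (n+1) → Ω → ℂ)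
          (insert 0 (I.map e1)) *
        jointCumulant μ (Fin.cons Y Xs : Fin (n+1) → Ω → ℂ) (insert 0 ((S \ I).map e1)))
    (mom_empty μ Xs) ?_ Finset.univ
  · have u1 : (Finset.univ : Finset (Fin (n+1))) = insert 0 (Finset.univ.map e1) := by
      ext x
      refine Fin.cases ?_ (fun i => ?_) x <;> simp [e1]
    have u2 : (Finset.univ : Finset (Fin (n+2))) =
        insert 0 (insert 1 (Finset.univ.map e2)) := by
      ext x
      refine Fin.cases ?_ (fun i => ?_) x
      · simp
      · refine Fin.cases ?_ (fun i => ?_) i <;> simp [e1, e2]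
    rw [cumulant, cumulant, u1, u2]
    exact main
  · intro S
    simp only [add_mul, Finset.sum_add_distrib]
    rw [← conv_assoc (fun I => jointCumulant μ (Fin.cons X Xs : Fin (n+1) → Ω → ℂ)
          (insert 0 (I.map e1)))
      (fun I => jointCumulant μ (Fin.cons Y Xs : Fin (n+1) → Ω → ℂ) (insert 0 (I.map e1)))]
    simp only [hY1, hXY, ← hXX]
    refine Eq.trans ?_ ((h2 S).symm.trans (add_comm _ _))
    congr 1
    ext ω
    exact mul_assoc _ _ _

end
end

section
/- Dixon–Anderson identity: for θ > 0 and real numbers x₁ < x₂ < ⋯ < x_N, ∫_{x₁}^{x₂} dy₁ ⋯ ∫_{x_{N−1}}^{x_N} dy_{N−1} ∏_{1≤i<j≤N−1}(y_j − y_i) ∏_{i=1}^{N−1}∏_{j=1}^{N} |y_i − x_j|^{θ−1} = (Γ(θ)^N / Γ(Nθ)) · ∏_{1≤i<j≤N}(x_j − x_i)^{2θ−1}. -/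
open MeasureTheory

namespace DixonAnderson

/-- Vandermonde product. -/
noncomputable def V {n : ℕ} (x : Fin n → ℝ) : ℝ :=
  ∏ i : Fin n, ∏ j ∈ Finset.univ.filter (fun j => i < j), (x j - x i)

/-- Product of differences to the other nodes. -/
noncomputable def D {N : ℕ} (x : Fin (N + 1) → ℝ) (j : Fin (N + 1)) : ℝ :=
  ∏ i : Fin N, (x j - x (j.succAbove i))

/-- The interlacing domain. -/
def dom {N : ℕ} (x : Fin (N + 1) → ℝ) : Set (Fin N → ℝ) :=
  {y | ∀ i : Fin N, x i.castSucc < y i ∧ y i < x i.succ}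

/-- The change of variables. -/
noncomputable def F {N : ℕ} (x : Fin (N + 1) → ℝ) (u : Fin (N + 1) → ℝ) (j : Fin (N + 1)) : ℝ :=
  u 0 * (∏ i : Fin N, (x j - u i.succ)) * (D x j)⁻¹

/-- Domain of the change of variables. -/
def S {N : ℕ} (x : Fin (N + 1) → ℝ) : Set (Fin (N + 1) → ℝ) :=
  {u | 0 < u 0 ∧ (fun i : Fin N => u i.succ) ∈ dom x}

lemma det_vdm {n : ℕ} (x : Fin n → ℝ) : (Matrix.vandermonde x).det = V x := by
  rw [Matrix.det_vandermonde, V]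
  refine Finset.prod_congr rfl fun i _ => Finset.prod_congr ?_ fun _ _ => rfl
  ext; simp

lemma V_pos {n : ℕ} {x : Fin n → ℝ} (hx : StrictMono x) : 0 < V x := by
  refine Finset.prod_pos fun i _ => Finset.prod_pos fun j hj => ?_
  simp at hj
  exact sub_pos.2 (hx hj)

lemma dom_mono {N : ℕ} {x : Fin (N + 1) → ℝ} (hx : StrictMono x) {y : Fin N → ℝ}
    (hy : y ∈ dom x) : StrictMono y := by
  intro i j hij
  have h1 := (hy i).2
  have h2 := (hy j).1
  have : x i.succ ≤ x j.castSucc := hx.monotone (by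
    rw [Fin.le_def]; simp; omega)
  linarith

lemma ratio_pos {N : ℕ} {x : Fin (N + 1) → ℝ} (hx : StrictMono x) {y : Fin N → ℝ}
    (hy : y ∈ dom x) (j : Fin (N + 1)) (i : Fin N) :
    0 < (x j - y i) * (x j - x (j.succAbove i)) := by
  rcases lt_or_ge i.castSucc j with h | h
  · rw [Fin.succAbove_of_castSucc_lt _ _ h]
    have h1 := hx h
    have h2 : x i.succ ≤ x j := hx.monotone (by rw [Fin.le_def]; rw [Fin.lt_def] at h; simp at *; omega)
    have := (hy i).2
    exact mul_pos (by linarith) (by linarith)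
  · rw [Fin.succAbove_of_le_castSucc _ _ h]
    have h1 := hx.monotone h
    have h2 : x j < x i.succ := hx (by rw [Fin.lt_def]; rw [Fin.le_def] at h; simp at *; omega)
    have := (hy i).1
    exact mul_pos_of_neg_of_neg (by linarith) (by linarith)

lemma D_ne {N : ℕ} {x : Fin (N + 1) → ℝ} (hx : StrictMono x) (j : Fin (N + 1)) : D x j ≠ 0 := by
  refine Finset.prod_ne_zero_iff.2 fun i _ => ?_
  rw [sub_ne_zero]
  exact fun h => Fin.succAbove_ne j i (hx.injective h).symm

lemma prodD_pos {N : ℕ} {x : Fin (N + 1) → ℝ} (hx : StrictMono x) {y : Fin N → ℝ}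
    (hy : y ∈ dom x) (j : Fin (N + 1)) : 0 < (∏ i, (x j - y i)) * (D x j)⁻¹ := by
  have : 0 < (∏ i, (x j - y i)) * D x j := by
    rw [D, ← Finset.prod_mul_distrib]
    exact Finset.prod_pos fun i _ => ratio_pos hx hy j i
  rcases pos_and_pos_or_neg_and_neg_of_mul_pos this with h | h
  · exact mul_pos h.1 (inv_pos.2 h.2)
  · exact mul_pos_of_neg_of_neg h.1 (inv_lt_zero.2 h.2)

lemma F_pos {N : ℕ} {x : Fin (N + 1) → ℝ} (hx : StrictMono x) {u : Fin (N + 1) → ℝ}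
    (hu : u ∈ S x) (j : Fin (N + 1)) : 0 < F x u j := by
  rw [F, mul_assoc]
  exact mul_pos hu.1 (prodD_pos hx hu.2 j)

lemma D_mul_neg {N : ℕ} {x : Fin (N + 1) → ℝ} (hx : StrictMono x) (i : Fin N) :
    D x i.castSucc * D x i.succ < 0 := by
  rw [D, D, ← Finset.prod_mul_distrib, ← Finset.mul_prod_erase _ _ (Finset.mem_univ i)]
  have h0 : x i.castSucc < x i.succ := hx (Fin.castSucc_lt_succ)
  refine mul_neg_of_neg_of_pos ?_ (Finset.prod_pos fun k hk => ?_)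
  · rw [Fin.succAbove_castSucc_self, Fin.succAbove_succ_self]
    exact mul_neg_of_neg_of_pos (by linarith) (by linarith)
  · have hk : k ≠ i := by simpa using hk
    rcases lt_or_gt_of_ne hk with h | h
    · rw [Fin.succAbove_of_castSucc_lt _ _ (by simpa using h),
        Fin.succAbove_of_castSucc_lt _ _ (by rw [Fin.lt_def] at *; simp; omega)]
      have : x k.castSucc < x i.castSucc := hx (by simpa using h)
      exact mul_pos (by linarith) (by linarith)
    · rw [Fin.succAbove_of_le_castSucc _ _ (by simpa using h.le),
        Fin.succAbove_of_le_castSucc _ _ (by rw [Fin.le_def, Fin.lt_def] at *; simp; omega)]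
      have : x i.succ < x k.succ := hx (by simpa using h)
      exact mul_pos_of_neg_of_neg (by linarith) (by linarith)

lemma erase_eq {N : ℕ} (f : Fin (N + 1) → ℝ) (j : Fin (N + 1)) :
    ∏ k ∈ Finset.univ.erase j, f k = ∏ i : Fin N, f (j.succAbove i) := by
  have : (Finset.univ.erase j : Finset (Fin (N + 1))) = Finset.univ.image j.succAbove := by
    rw [Fin.image_succAbove_univ]; ext; simp
  rw [this, Finset.prod_image (Fin.succAbove_right_injective.injOn)]

open Polynomial in
lemma prod_deg {N : ℕ} (y : Fin N → ℝ) :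
    (∏ i, (X - C (y i)) : ℝ[X]).natDegree = N := by
  simp

open Polynomial in
lemma prod_monic {N : ℕ} (y : Fin N → ℝ) :
    (∏ i, (X - C (y i)) : ℝ[X]).Monic := monic_prod_X_sub_C _ _

open Polynomial in
lemma sum_F {N : ℕ} {x : Fin (N + 1) → ℝ} (hx : StrictMono x) (u : Fin (N + 1) → ℝ) :
    ∑ j, F x u j = u 0 := by
  have h := Lagrange.leadingCoeff_eq_sum (s := Finset.univ) (v := x) (hx.injective.injOn)
    (P := ∏ i : Fin N, (X - C (u i.succ)))
    (by rw [degree_eq_natDegree (prod_monic _).ne_zero, prod_deg]; simp)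
  rw [(prod_monic _).leadingCoeff] at h
  simp only [F, mul_assoc, ← Finset.mul_sum]
  simp only [erase_eq (fun k => _ - x k), eval_prod, eval_sub, eval_X, eval_C, div_eq_mul_inv] at h
  unfold D
  rw [← h, mul_one]

open Polynomial in
lemma F_inj {N : ℕ} {x : Fin (N + 1) → ℝ} (hx : StrictMono x) : Set.InjOn (F x) (S x) := by
  intro u hu v hv h
  have h0 : u 0 = v 0 := by rw [← sum_F hx u, ← sum_F hx v, h]
  have hdeg : ∀ y : Fin N → ℝ, (∏ i, (X - C (y i)) : ℝ[X]).degree <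
      (Finset.univ : Finset (Fin (N + 1))).card := by
    intro y
    rw [degree_eq_natDegree (prod_monic _).ne_zero, prod_deg]; simp
    exact_mod_cast Nat.lt_succ_self N
  have hp := Polynomial.eq_of_degrees_lt_of_eval_index_eq (s := Finset.univ) (v := x)
    (f := ∏ i : Fin N, (X - C (u i.succ))) (g := ∏ i : Fin N, (X - C (v i.succ)))
    hx.injective.injOn (hdeg _) (hdeg _) (by
      intro j _
      have := congrFun h j
      rw [F, F, h0] at this
      have := mul_left_cancel₀ hv.1.ne' (mul_right_cancel₀ (inv_ne_zero (D_ne hx j)) this)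
      simpa [eval_prod] using this)
  ext k
  refine Fin.cases h0 (fun i => ?_) k
  have he := congrArg (eval (u i.succ)) hp
  simp only [eval_prod, eval_sub, eval_X, eval_C] at he
  rw [Finset.prod_eq_zero (Finset.mem_univ i) (sub_self _)] at he
  obtain ⟨k, -, hk⟩ := Finset.prod_eq_zero_iff.1 he.symm
  have hk : u i.succ = v k.succ := sub_eq_zero.1 hk
  suffices k = i by rw [hk, this]
  have a1 := hu.2 i
  have a2 := hv.2 k
  simp only at a1 a2
  rcases lt_trichotomy k i with hki | hki | hki
  · have : x k.succ ≤ x i.castSucc := hx.monotone (by rw [Fin.le_def]; simp; omega)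
    linarith [a1.1, a2.2]
  · exact hki
  · have : x i.succ ≤ x k.castSucc := hx.monotone (by rw [Fin.le_def]; simp; omega)
    linarith [a1.2, a2.1]

open Polynomial in
lemma F_surj {N : ℕ} {x : Fin (N + 1) → ℝ} (hx : StrictMono x) {t : Fin (N + 1) → ℝ}
    (ht : ∀ j, 0 < t j) : ∃ u ∈ S x, F x u = t := by
  set P : ℝ[X] := Lagrange.interpolate Finset.univ x (fun j => t j * D x j) with hP
  have hPe : ∀ j, P.eval (x j) = t j * D x j := fun j =>
    Lagrange.eval_interpolate_at_node _ hx.injective.injOn (Finset.mem_univ j)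
  have hPd : P.degree < (Finset.univ : Finset (Fin (N + 1))).card :=
    Lagrange.degree_interpolate_lt _ hx.injective.injOn
  have hroot : ∀ i : Fin N, ∃ y, (x i.castSucc < y ∧ y < x i.succ) ∧ P.eval y = 0 := by
    intro i
    have h0 : x i.castSucc < x i.succ := hx (Fin.castSucc_lt_succ)
    have hneg : P.eval (x i.castSucc) * P.eval (x i.succ) < 0 := by
      rw [hPe, hPe]
      have := mul_neg_of_pos_of_neg (mul_pos (ht i.castSucc) (ht i.succ)) (D_mul_neg hx i)
      nlinarith
    rcases mul_neg_iff.1 hneg with h | h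
    · obtain ⟨y, hy, hy'⟩ := intermediate_value_Ioo' h0.le (f := fun z => P.eval z)
        P.continuous.continuousOn ⟨h.2, h.1⟩
      exact ⟨y, hy, hy'⟩
    · obtain ⟨y, hy, hy'⟩ := intermediate_value_Ioo h0.le (f := fun z => P.eval z)
        P.continuous.continuousOn h
      exact ⟨y, hy, hy'⟩
  choose y hy hy0 using hroot
  have hyd : y ∈ dom x := hy
  have hdvd : (∏ i, (X - C (y i))) ∣ P := by
    refine Fintype.prod_dvd_of_coprime ?_ fun i => dvd_iff_isRoot.2 (hy0 i)
    exact pairwise_coprime_X_sub_C (dom_mono hx hyd).injective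
  obtain ⟨Q, hQ⟩ := hdvd
  have hP0 : P ≠ 0 := by
    intro h
    have := hPe 0
    rw [h, eval_zero] at this
    exact mul_ne_zero (ht 0).ne' (D_ne hx 0) this.symm
  have hQ0 : Q ≠ 0 := by rintro rfl; simp at hQ; exact hP0 hQ
  have hQd : Q.natDegree = 0 := by
    have h1 := congrArg natDegree hQ
    rw [natDegree_mul (prod_monic _).ne_zero hQ0, prod_deg] at h1
    have h2 : P.natDegree < N + 1 := by
      rw [natDegree_lt_iff_degree_lt hP0]; simpa using hPd
    omega
  rw [eq_C_of_natDegree_eq_zero hQd] at hQ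
  set s := Q.coeff 0
  have hs : ∀ j, s * (∏ i, (x j - y i)) = t j * D x j := by
    intro j
    rw [← hPe j, hQ]
    simp [eval_prod, mul_comm]
  have hF : F x (Fin.cons s y) = t := by
    ext j
    simp only [F, Fin.cons_zero, Fin.cons_succ]
    rw [hs j, mul_assoc, mul_inv_cancel₀ (D_ne hx j), mul_one]
  refine ⟨Fin.cons s y, ⟨?_, ?_⟩, hF⟩
  · have h1 := prodD_pos hx hyd 0
    have h2 := ht 0
    rw [← congrFun hF 0, F, mul_assoc] at h2
    simp only [Fin.cons_zero, Fin.cons_succ] at h2 ⊢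
    exact pos_of_mul_pos_left h2 h1.le
  · simpa using hyd

lemma F_image {N : ℕ} {x : Fin (N + 1) → ℝ} (hx : StrictMono x) :
    F x '' S x = Set.univ.pi (fun _ => Set.Ioi 0) := by
  ext t
  simp only [Set.mem_image, Set.mem_pi, Set.mem_univ, forall_true_left, Set.mem_Ioi]
  constructor
  · rintro ⟨u, hu, rfl⟩ j
    exact F_pos hx hu j
  · intro ht
    exact F_surj hx ht

lemma V_sq {n : ℕ} (x : Fin n → ℝ) :
    ∏ i, ∏ j ∈ Finset.univ.erase i, |x i - x j| = |V x| ^ 2 := by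
  have h1 : ∀ i, ∏ j ∈ Finset.univ.erase i, |x i - x j| =
      (∏ j ∈ Finset.univ.filter (fun j => i < j), |x j - x i|) *
      (∏ j ∈ Finset.univ.filter (fun j => j < i), |x i - x j|) := by
    intro i
    rw [← Finset.prod_filter_mul_prod_filter_not _ (fun j => i < j)]
    congr 1
    · refine Finset.prod_congr ?_ fun _ _ => abs_sub_comm _ _
      ext j; simp; intro h; exact h.ne'
    · refine Finset.prod_congr ?_ fun _ _ => rfl
      ext j; simp; exact ⟨fun h => lt_of_le_of_ne h.2 h.1, fun h => ⟨h.ne, h.le⟩⟩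
  simp only [h1, Finset.prod_mul_distrib]
  rw [sq, V, Finset.abs_prod]
  simp only [Finset.abs_prod]
  congr 1
  rw [Finset.prod_comm' (t' := Finset.univ)
    (s' := fun j => Finset.univ.filter (fun i => j < i))]
  simp


/-- Polynomials for the Jacobian columns. -/
noncomputable def q {N : ℕ} (y : Fin N → ℝ) : Fin (N + 1) → Polynomial ℝ :=
  Fin.cons (∏ i, (Polynomial.X - Polynomial.C (y i)))
    (fun i => ∏ k ∈ Finset.univ.erase i, (Polynomial.X - Polynomial.C (y k)))

/-- Evaluation matrix. -/
noncomputable def A {N : ℕ} (x : Fin (N + 1) → ℝ) (y : Fin N → ℝ) :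
    Matrix (Fin (N + 1)) (Fin (N + 1)) ℝ :=
  Matrix.of fun j k => (q y k).eval (x j)

lemma q_deg {N : ℕ} (y : Fin N → ℝ) (k : Fin (N + 1)) : (q y k).natDegree < N + 1 := by
  refine Fin.cases ?_ (fun i => ?_) k
  · simp [q]
  · simp only [q, Fin.cons_succ]
    rw [Polynomial.natDegree_prod_of_monic _ _ (fun k _ => Polynomial.monic_X_sub_C _)]
    simp

lemma A_eq {N : ℕ} (x : Fin (N + 1) → ℝ) (y : Fin N → ℝ) :
    A x y = Matrix.vandermonde x * Matrix.of fun l k => (q y k).coeff (l : Fin (N + 1)) := by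
  ext j k
  rw [A, Matrix.mul_apply, Matrix.of_apply, Polynomial.eval_eq_sum_range' (q_deg y k),
    Finset.sum_range]
  refine Finset.sum_congr rfl fun l _ => ?_
  simp [Matrix.vandermonde_apply, mul_comm]

lemma det_A_cons {N : ℕ} (z : ℝ) (y : Fin N → ℝ) :
    (A (Fin.cons z y) y).det = (∏ i, (z - y i)) * ∏ i, ∏ k ∈ Finset.univ.erase i, (y i - y k) := by
  rw [Matrix.det_succ_column_zero, Fin.sum_univ_succ]
  have h0 : ∀ i : Fin N, A (Fin.cons z y) y i.succ 0 = 0 := by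
    intro i
    simp only [A, q, Matrix.of_apply, Fin.cons_succ, Fin.cons_zero, Polynomial.eval_prod]
    exact Finset.prod_eq_zero (Finset.mem_univ i) (by simp)
  simp only [h0, mul_zero, zero_mul, Finset.sum_const_zero, add_zero]
  have h1 : (A (Fin.cons z y) y).submatrix (Fin.succAbove 0) Fin.succ =
      Matrix.diagonal fun i => ∏ k ∈ Finset.univ.erase i, (y i - y k) := by
    ext i k
    simp only [A, q, Matrix.submatrix_apply, Matrix.of_apply, Fin.succAbove_zero, Fin.cons_succ,
      Polynomial.eval_prod, Matrix.diagonal_apply]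
    split_ifs with h
    · subst h; simp
    · exact Finset.prod_eq_zero (i := i) (by simp [h]) (by simp)
  rw [h1, Matrix.det_diagonal]
  simp [A, q, Polynomial.eval_prod]

lemma V_cons {N : ℕ} (z : ℝ) (y : Fin N → ℝ) :
    V (Fin.cons z y : Fin (N + 1) → ℝ) = (∏ i, (y i - z)) * V y := by
  rw [← det_vdm, ← det_vdm, Matrix.det_vandermonde, Matrix.det_vandermonde, Fin.prod_univ_succ]
  simp

lemma det_A {N : ℕ} (x : Fin (N + 1) → ℝ) {y : Fin N → ℝ} (hy : StrictMono y) :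
    |(A x y).det| = |V x| * V y := by
  obtain ⟨z, hz⟩ : ∃ z, z ∉ Set.range y := (Set.finite_range y).exists_notMem
  have hz' : ∀ i, z - y i ≠ 0 := fun i h => hz ⟨i, (sub_eq_zero.1 h).symm⟩
  have h1 := congrArg abs (det_A_cons z y)
  rw [A_eq, Matrix.det_mul, det_vdm, V_cons, abs_mul, abs_mul, abs_mul] at h1
  have h2 := V_sq y
  simp only [← Finset.abs_prod] at h2
  have h3 : |∏ i, (y i - z)| = |∏ i, (z - y i)| := by
    simp only [Finset.abs_prod, abs_sub_comm]
  have h4 : |∏ i, (z - y i)| ≠ 0 := abs_ne_zero.2 (Finset.prod_ne_zero_iff.2 fun i _ => hz' i)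
  have hV := V_pos hy
  rw [h2, h3, abs_of_pos hV, mul_assoc] at h1
  have h5 := mul_left_cancel₀ h4 h1
  rw [sq] at h5
  have h6 := mul_left_cancel₀ hV.ne' h5
  rw [A_eq, Matrix.det_mul, det_vdm, abs_mul, h6]

/-- Jacobian matrix. -/
noncomputable def M {N : ℕ} (x u : Fin (N + 1) → ℝ) : Matrix (Fin (N + 1)) (Fin (N + 1)) ℝ :=
  Matrix.diagonal (fun j => (D x j)⁻¹) * A x (fun i => u i.succ) *
    Matrix.diagonal (Fin.cons 1 (fun _ => - u 0) : Fin (N + 1) → ℝ)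

lemma F_deriv {N : ℕ} (x u : Fin (N + 1) → ℝ) :
    HasFDerivAt (F x) (LinearMap.toContinuousLinearMap (Matrix.toLin' (M x u))) u := by
  rw [hasFDerivAt_pi']
  intro j
  have hp : ∀ k : Fin (N + 1), HasFDerivAt (fun u : Fin (N + 1) → ℝ => u k)
    (ContinuousLinearMap.proj (R := ℝ) (φ := fun _ : Fin (N + 1) => ℝ) k) u :=
    fun k => hasFDerivAt_apply k u
  have h := ((hp 0).mul (HasFDerivAt.finsetProd (u := Finset.univ)
    (fun (i : Fin N) _ => (hp i.succ).const_sub (x j)))).mul_const (D x j)⁻¹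
  refine h.congr_fderiv ?_
  ext v
  simp [M, Matrix.mulVec, dotProduct, Fin.sum_univ_succ, A, q, Polynomial.eval_prod,
    Finset.mul_sum, Finset.sum_mul, mul_add, Finset.sum_neg_distrib]
  rw [add_comm]
  congr 1
  · ring
  · congr 1
    refine Finset.sum_congr rfl fun i _ => ?_
    ring

lemma prod_absD {N : ℕ} {x : Fin (N + 1) → ℝ} (hx : StrictMono x) :
    ∏ j, |D x j| = V x ^ 2 := by
  rw [← abs_of_pos (V_pos hx), ← V_sq]
  refine Finset.prod_congr rfl fun j _ => ?_
  rw [D, Finset.abs_prod, ← erase_eq (fun k => |x j - x k|)]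

lemma det_M {N : ℕ} {x u : Fin (N + 1) → ℝ} (hx : StrictMono x) (hu : u ∈ S x) :
    |(LinearMap.toContinuousLinearMap (Matrix.toLin' (M x u))).det| =
      u 0 ^ N * V (fun i : Fin N => u i.succ) / V x := by
  have hV := V_pos hx
  rw [ContinuousLinearMap.det, LinearMap.coe_toContinuousLinearMap, LinearMap.det_toLin', M,
    Matrix.det_mul, Matrix.det_mul, Matrix.det_diagonal, Matrix.det_diagonal, abs_mul, abs_mul,
    det_A x (dom_mono hx hu.2), Finset.abs_prod, abs_of_pos hV]
  simp only [abs_inv, Finset.prod_inv_distrib]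
  rw [prod_absD hx, Fin.prod_univ_succ]
  simp [abs_of_pos hu.1]
  field_simp

lemma F_rpow {N : ℕ} {x u : Fin (N + 1) → ℝ} (hx : StrictMono x) (hu : u ∈ S x) (a : ℝ) :
    ∏ j, F x u j ^ a = u 0 ^ ((N + 1) * a) *
      (∏ i : Fin N, ∏ j, |u i.succ - x j| ^ a) * V x ^ (-(2 * a)) := by
  have hV := V_pos hx
  have h1 : ∀ j, F x u j ^ a = u 0 ^ a * (∏ i : Fin N, |u i.succ - x j| ^ a) * (|D x j| ^ a)⁻¹ := by
    intro j
    rw [← abs_of_pos (F_pos hx hu j), F, abs_mul, abs_mul, abs_of_pos hu.1, abs_inv,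
      Real.mul_rpow (by positivity [hu.1]) (by positivity),
      Real.mul_rpow hu.1.le (by positivity), Real.inv_rpow (by positivity), Finset.abs_prod,
      ← Real.finsetProd_rpow _ _ (fun _ _ => abs_nonneg _)]
    simp only [abs_sub_comm]
  simp only [h1, Finset.prod_mul_distrib, Finset.prod_inv_distrib]
  rw [Real.finsetProd_rpow _ _ (fun _ _ => abs_nonneg _), prod_absD hx, Finset.prod_comm]
  congr 1
  · congr 1
    simp
    rw [← Real.rpow_natCast, ← Real.rpow_mul hu.1.le]
    push_cast; ring_nf
  · rw [Real.rpow_neg hV.le, ← Real.rpow_natCast, ← Real.rpow_mul hV.le]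
    norm_num

lemma dom_meas {N : ℕ} (x : Fin (N + 1) → ℝ) : MeasurableSet (dom x) := by
  have : dom x = Set.univ.pi (fun i : Fin N => Set.Ioo (x i.castSucc) (x i.succ)) := by
    ext y; simp [dom]
  rw [this]
  exact MeasurableSet.univ_pi fun i => measurableSet_Ioo

lemma S_meas {N : ℕ} (x : Fin (N + 1) → ℝ) : MeasurableSet (S x) := by
  refine MeasurableSet.inter ?_ ?_
  · exact measurableSet_lt measurable_const (measurable_pi_apply 0)
  · have : Measurable (fun (u : Fin (N + 1) → ℝ) (i : Fin N) => u i.succ) :=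
      measurable_pi_lambda _ fun i => measurable_pi_apply _
    exact this (dom_meas x)

lemma split {N : ℕ} (x : Fin (N + 1) → ℝ) (f : ℝ → ℝ) (g : (Fin N → ℝ) → ℝ) :
    ∫ u in S x, f (u 0) * g (fun i => u i.succ) =
      (∫ s in Set.Ioi 0, f s) * ∫ y in dom x, g y := by
  rw [← setIntegral_prod_mul]
  have h := (volume_preserving_piFinSuccAbove (fun _ : Fin (N + 1) => ℝ) 0)
  rw [← Measure.volume_eq_prod, ← h.setIntegral_preimage_emb (MeasurableEquiv.measurableEmbedding _)]
  rfl

theorem main (N : ℕ) (θ : ℝ) (hθ : 0 < θ) (x : Fin (N + 1) → ℝ) (hx : StrictMono x) :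
    (∫ y in dom x, V y * ∏ i : Fin N, ∏ j : Fin (N + 1), |y i - x j| ^ (θ - 1)) =
      Real.Gamma θ ^ (N + 1) / Real.Gamma (((N : ℝ) + 1) * θ) * V x ^ (2 * θ - 1) := by
  have hV := V_pos hx
  have h1 : ∫ t in Set.univ.pi (fun _ : Fin (N + 1) => Set.Ioi (0 : ℝ)),
      ∏ j, (Real.exp (-(t j)) * t j ^ (θ - 1)) = Real.Gamma θ ^ (N + 1) := by
    rw [volume_pi, Measure.restrict_pi_pi,
      integral_fintype_prod_eq_pow (fun s : ℝ => Real.exp (-s) * s ^ (θ - 1)),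
      ← Real.Gamma_eq_integral hθ, Fintype.card_fin]
  rw [← F_image hx, integral_image_eq_integral_abs_det_fderiv_smul volume (S_meas x)
    (fun u _ => (F_deriv x u).hasFDerivWithinAt) (F_inj hx)] at h1
  have h2 : ∀ u ∈ S x, |(LinearMap.toContinuousLinearMap (Matrix.toLin' (M x u))).det| •
      ∏ j, (Real.exp (-(F x u j)) * F x u j ^ (θ - 1)) =
      (fun s => Real.exp (-s) * s ^ ((N + 1) * θ - 1)) (u 0) *
      (fun y : Fin N → ℝ => V x ^ (-(2 * θ - 1)) *
        (V y * ∏ i : Fin N, ∏ j : Fin (N + 1), |y i - x j| ^ (θ - 1))) (fun i => u i.succ) := by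
    intro u hu
    rw [det_M hx hu, Finset.prod_mul_distrib, F_rpow hx hu, ← Real.exp_sum,
      Finset.sum_neg_distrib, sum_F hx]
    have e1 : u 0 ^ (((N : ℝ) + 1) * θ - 1) = u 0 ^ N * u 0 ^ ((N + 1) * (θ - 1)) := by
      rw [← Real.rpow_natCast, ← Real.rpow_add hu.1]; congr 1; ring
    have e2 : V x ^ (-(2 * θ - 1)) = V x ^ (-(2 * (θ - 1))) / V x := by
      rw [← Real.rpow_sub_one hV.ne']; congr 1; ring
    simp only [e1, e2, smul_eq_mul]
    ring
  rw [setIntegral_congr_fun (S_meas x) h2,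
    split x (fun s => Real.exp (-s) * s ^ ((N + 1) * θ - 1))
      (fun y : Fin N → ℝ => V x ^ (-(2 * θ - 1)) *
        (V y * ∏ i : Fin N, ∏ j : Fin (N + 1), |y i - x j| ^ (θ - 1))), ← Real.Gamma_eq_integral (by positivity),
    integral_const_mul] at h1
  have hG : 0 < Real.Gamma (((N : ℝ) + 1) * θ) := Real.Gamma_pos_of_pos (by positivity)
  rw [← h1, Real.rpow_neg hV.le]
  have := Real.rpow_pos_of_pos hV (2 * θ - 1)
  field_simp

end DixonAnderson

theorem dixon_anderson (N : ℕ) (θ : ℝ) (hθ : 0 < θ) (x : Fin (N + 1) → ℝ)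
    (hx : StrictMono x) :
    (∫ y : Fin N → ℝ in
        {y | ∀ i : Fin N, x i.castSucc < y i ∧ y i < x i.succ},
      (∏ i : Fin N, ∏ j ∈ Finset.univ.filter (fun j => i < j), (y j - y i)) *
        ∏ i : Fin N, ∏ j : Fin (N + 1), |y i - x j| ^ (θ - 1)) =
      Real.Gamma θ ^ (N + 1) / Real.Gamma (((N : ℝ) + 1) * θ) *
        ∏ i : Fin (N + 1), ∏ j ∈ Finset.univ.filter (fun j => i < j),
          (x j - x i) ^ (2 * θ - 1) := by
  have h := DixonAnderson.main N θ hθ x hx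
  have e : DixonAnderson.V x ^ (2 * θ - 1) =
      ∏ i : Fin (N + 1), ∏ j ∈ Finset.univ.filter (fun j => i < j),
          (x j - x i) ^ (2 * θ - 1) := by
    have hn : ∀ i : Fin (N + 1), ∀ j ∈ Finset.univ.filter (fun j => i < j), 0 ≤ x j - x i := by
      intro i j hj
      simp at hj
      exact (sub_pos.2 (hx hj)).le
    rw [DixonAnderson.V, ← Real.finsetProd_rpow _ _ (fun i _ => Finset.prod_nonneg (hn i))]
    refine Finset.prod_congr rfl fun i _ => ?_
    rw [Real.finsetProd_rpow _ _ (hn i)]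
  rw [e] at h
  exact h
end

section
/- Cauchy identity specialization: for N ∈ ℕ, θ > 0 and q ∈ [0,1), ∑_{λ} (∏_{i=1}^N q^{λᵢ}) · J_λ(1^N) · Ĵ_λ(1^N) = (1 − q)^{−θN²}, where the sum is over all partitions λ = (λ₁ ≥ ⋯ ≥ λ_N ≥ 0) with integer parts. -/
open Finset

noncomputable section

/-- `ℓ_i = λ_i − iθ` (1-based index `i`; here `i : Fin n` is 0-based). -/
def ell (θ : ℝ) {n : ℕ} (lam : Fin n → ℕ) (i : Fin n) : ℝ :=
  (lam i : ℝ) - ((i : ℕ) + 1) * θ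

/-- `J_λ(1^N) = ∏_{i=1}^N Γ(θ)/Γ(iθ) · ∏_{i<j} Γ(ℓᵢ−ℓⱼ+θ)/Γ(ℓᵢ−ℓⱼ)`. -/
def jackOne (θ : ℝ) {n : ℕ} (lam : Fin n → ℕ) : ℝ :=
  (∏ i : Fin n, Real.Gamma θ / Real.Gamma (((i : ℕ) + 1) * θ)) *
    ∏ i : Fin n, ∏ j ∈ Finset.univ.filter (fun j => i < j),
      Real.Gamma (ell θ lam i - ell θ lam j + θ) / Real.Gamma (ell θ lam i - ell θ lam j)

/-- `Ĵ_λ(1^N) = ∏_{i=1}^N 1/Γ(iθ) · ∏_{i<j} Γ(ℓᵢ−ℓⱼ+1)/Γ(ℓᵢ−ℓⱼ+1−θ)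
· ∏_i Γ(ℓᵢ+θN+θ)/Γ(ℓᵢ+θN+1)`. -/
def jackDualOne (θ : ℝ) {n : ℕ} (lam : Fin n → ℕ) : ℝ :=
  (∏ i : Fin n, 1 / Real.Gamma (((i : ℕ) + 1) * θ)) *
    (∏ i : Fin n, ∏ j ∈ Finset.univ.filter (fun j => i < j),
      Real.Gamma (ell θ lam i - ell θ lam j + 1) /
        Real.Gamma (ell θ lam i - ell θ lam j + 1 - θ)) *
    ∏ i : Fin n,
      Real.Gamma (ell θ lam i + θ * n + θ) / Real.Gamma (ell θ lam i + θ * n + 1)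

/-! ### Partial-fraction identities -/

/-- The partial-fraction coefficient. -/
def pfc {ι : Type*} [DecidableEq ι] (t : ℝ) (x : ι → ℝ) (s : Finset ι) (k : ι) : ℝ :=
  ∏ j ∈ s.erase k, (1 + t / (x k - x j))

lemma pfc_insert {ι : Type*} [DecidableEq ι] (t : ℝ) (x : ι → ℝ) (s : Finset ι) (a k : ι)
    (ha : a ∉ s) (hk : k ∈ s) :
    pfc t x (insert a s) k = pfc t x s k * (1 + t / (x k - x a)) := by
  have hne : a ≠ k := fun h => ha (h ▸ hk)
  unfold pfc
  rw [Finset.erase_insert_of_ne hne, Finset.prod_insert (by simp [ha]), mul_comm]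

lemma pfc_insert_self {ι : Type*} [DecidableEq ι] (t : ℝ) (x : ι → ℝ) (s : Finset ι) (a : ι)
    (ha : a ∉ s) :
    pfc t x (insert a s) a = ∏ j ∈ s, (1 + t / (x a - x j)) := by
  unfold pfc
  rw [Finset.erase_insert ha]

lemma pf_expand {ι : Type*} [DecidableEq ι] (t : ℝ) (x : ι → ℝ) (hx : Function.Injective x)
    (s : Finset ι) : ∀ y : ℝ, (∀ j ∈ s, y ≠ x j) →
    ∏ j ∈ s, (1 + t / (y - x j)) = 1 + t * ∑ k ∈ s, pfc t x s k / (y - x k) := by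
  induction s using Finset.induction_on with
  | empty => intro y _; simp
  | insert a s ha ih =>
    intro y hy
    have hya : y - x a ≠ 0 := sub_ne_zero.2 (hy a (by simp))
    rw [Finset.prod_insert ha, Finset.sum_insert ha, pfc_insert_self t x s a ha,
      ih y (fun j hj => hy j (by simp [hj])),
      ih (x a) (fun j hj h => ha (hx h ▸ hj))]
    have : ∑ k ∈ s, pfc t x (insert a s) k / (y - x k) =
        ∑ k ∈ s, (pfc t x s k / (y - x k) + t / (y - x a) * (pfc t x s k / (y - x k))
          - t / (y - x a) * (pfc t x s k / (x a - x k))) := by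
      refine Finset.sum_congr rfl fun k hk => ?_
      rw [pfc_insert t x s a k ha hk]
      have h1 : y - x k ≠ 0 := sub_ne_zero.2 (hy k (by simp [hk]))
      have h2 : x a - x k ≠ 0 := sub_ne_zero.2 (fun h => ha (hx h ▸ hk))
      have h3 : x k - x a ≠ 0 := sub_ne_zero.2 (fun h => ha (hx h ▸ hk))
      have h4 : t / (x k - x a) = - (t / (x a - x k)) := by
        rw [← neg_sub (x a) (x k), div_neg]
      rw [h4]
      field_simp
      ring
    rw [this, Finset.sum_sub_distrib, Finset.sum_add_distrib, ← Finset.mul_sum, ← Finset.mul_sum]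
    field_simp
    ring

lemma pf_sum0 {ι : Type*} [DecidableEq ι] (t : ℝ) (x : ι → ℝ) (hx : Function.Injective x)
    (s : Finset ι) : ∑ k ∈ s, pfc t x s k = s.card := by
  induction s using Finset.induction_on with
  | empty => simp
  | insert a s ha ih =>
    rw [Finset.sum_insert ha, pfc_insert_self t x s a ha,
      pf_expand t x hx s (x a) (fun j hj h => ha (hx h ▸ hj)), Finset.card_insert_of_notMem ha]
    have : ∑ k ∈ s, pfc t x (insert a s) k =
        ∑ k ∈ s, (pfc t x s k - t * (pfc t x s k / (x a - x k))) := by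
      refine Finset.sum_congr rfl fun k hk => ?_
      rw [pfc_insert t x s a k ha hk]
      rw [← neg_sub (x a) (x k), div_neg]
      ring
    rw [this, Finset.sum_sub_distrib, ← Finset.mul_sum, ih]
    push_cast
    ring

lemma pf_sum1 {ι : Type*} [DecidableEq ι] (t : ℝ) (x : ι → ℝ) (hx : Function.Injective x)
    (s : Finset ι) : ∑ k ∈ s, x k * pfc t x s k =
      ∑ k ∈ s, x k + t * (s.card * (s.card - 1) / 2) := by
  induction s using Finset.induction_on with
  | empty => simp
  | insert a s ha ih =>
    rw [Finset.sum_insert ha, pfc_insert_self t x s a ha,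
      pf_expand t x hx s (x a) (fun j hj h => ha (hx h ▸ hj)), Finset.card_insert_of_notMem ha,
      Finset.sum_insert ha]
    have : ∑ k ∈ s, x k * pfc t x (insert a s) k =
        ∑ k ∈ s, (x k * pfc t x s k + t * pfc t x s k
          - x a * t * (pfc t x s k / (x a - x k))) := by
      refine Finset.sum_congr rfl fun k hk => ?_
      rw [pfc_insert t x s a k ha hk]
      have h2 : x a - x k ≠ 0 := sub_ne_zero.2 (fun h => ha (hx h ▸ hk))
      rw [← neg_sub (x a) (x k), div_neg]
      field_simp
      ring
    rw [this, Finset.sum_sub_distrib, Finset.sum_add_distrib, ← Finset.mul_sum, ← Finset.mul_sum,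
      ih, pf_sum0 t x hx s]
    push_cast
    ring

/-! ### Weights -/

/-- The coefficient of a partition. -/
def jw (θ : ℝ) {n : ℕ} (f : Fin n → ℕ) : ℝ := jackOne θ f * jackDualOne θ f

/-- Extension by zero to all tuples. -/
def jW (θ : ℝ) {n : ℕ} (f : Fin n → ℕ) : ℝ :=
  open Classical in if Antitone f then jw θ f else 0

/-- Up rates. -/
def upA (θ : ℝ) {n : ℕ} (f : Fin n → ℕ) (k : Fin n) : ℝ :=
  (ell θ f k + θ * n + θ) * pfc θ (ell θ f) univ k

/-- Down rates. -/
def dnB (θ : ℝ) {n : ℕ} (f : Fin n → ℕ) (k : Fin n) : ℝ :=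
  (ell θ f k + θ * n) * pfc (-θ) (ell θ f) univ k

lemma ell_gap {θ : ℝ} (hθ : 0 < θ) {n : ℕ} {f : Fin n → ℕ} (hf : Antitone f) {i j : Fin n}
    (hij : i < j) : θ ≤ ell θ f i - ell θ f j := by
  unfold ell
  have h1 : (f j : ℝ) ≤ f i := by exact_mod_cast hf hij.le
  have h2 : ((i : ℕ) : ℝ) + 1 ≤ (j : ℕ) := by exact_mod_cast hij
  nlinarith

lemma ell_inj {θ : ℝ} (hθ : 0 < θ) {n : ℕ} {f : Fin n → ℕ} (hf : Antitone f) :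
    Function.Injective (ell θ f) := by
  intro i j h
  rcases lt_trichotomy i j with h1 | h1 | h1
  · have := ell_gap hθ hf h1; linarith
  · exact h1
  · have := ell_gap hθ hf h1; linarith

lemma ell_pos {θ : ℝ} (hθ : 0 < θ) {n : ℕ} (f : Fin n → ℕ) (i : Fin n) :
    0 ≤ ell θ f i + θ * n := by
  unfold ell
  have h2 : ((i : ℕ) : ℝ) + 1 ≤ (n : ℕ) := by exact_mod_cast i.2
  have : (0 : ℝ) ≤ f i := by positivity
  nlinarith

lemma sum_fin_cast (n : ℕ) : ∑ i : Fin n, (((i : ℕ) : ℝ) + 1) = n * (n + 1) / 2 := by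
  induction n with
  | zero => simp
  | succ n ih => rw [Fin.sum_univ_castSucc]; simp only [Fin.val_castSucc, ih, Fin.val_last]; push_cast; ring

lemma ell_sum (θ : ℝ) {n : ℕ} (f : Fin n → ℕ) :
    ∑ i, ell θ f i = ((∑ i, f i : ℕ) : ℝ) - θ * (n * (n + 1) / 2) := by
  unfold ell
  rw [Finset.sum_sub_distrib, ← Finset.sum_mul, sum_fin_cast]
  push_cast
  ring

lemma upA_sum {θ : ℝ} (hθ : 0 < θ) {n : ℕ} {f : Fin n → ℕ} (hf : Antitone f) :
    ∑ k, upA θ f k = ((∑ i, f i : ℕ) : ℝ) + θ * (n : ℝ) ^ 2 := by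
  have h0 := pf_sum0 θ (ell θ f) (ell_inj hθ hf) univ
  have h1 := pf_sum1 θ (ell θ f) (ell_inj hθ hf) univ
  have : ∑ k, upA θ f k = ∑ k, ell θ f k * pfc θ (ell θ f) univ k +
      (θ * n + θ) * ∑ k, pfc θ (ell θ f) univ k := by
    rw [Finset.mul_sum, ← Finset.sum_add_distrib]
    exact Finset.sum_congr rfl fun k _ => by unfold upA; ring
  rw [this, h0, h1, ell_sum]
  simp only [Finset.card_univ, Fintype.card_fin]
  ring

lemma dnB_sum {θ : ℝ} (hθ : 0 < θ) {n : ℕ} {f : Fin n → ℕ} (hf : Antitone f) :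
    ∑ k, dnB θ f k = ((∑ i, f i : ℕ) : ℝ) := by
  have h0 := pf_sum0 (-θ) (ell θ f) (ell_inj hθ hf) univ
  have h1 := pf_sum1 (-θ) (ell θ f) (ell_inj hθ hf) univ
  have : ∑ k, dnB θ f k = ∑ k, ell θ f k * pfc (-θ) (ell θ f) univ k +
      (θ * n) * ∑ k, pfc (-θ) (ell θ f) univ k := by
    rw [Finset.mul_sum, ← Finset.sum_add_distrib]
    exact Finset.sum_congr rfl fun k _ => by unfold dnB; ring
  rw [this, h0, h1, ell_sum]
  simp only [Finset.card_univ, Fintype.card_fin]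
  ring

/-- Pair factor. -/
def pF (θ D : ℝ) : ℝ :=
  Real.Gamma (D + θ) / Real.Gamma D * (Real.Gamma (D + 1) / Real.Gamma (D + 1 - θ))

/-- Single factor. -/
def pG (θ x : ℝ) : ℝ := Real.Gamma (x + θ) / Real.Gamma (x + 1)

/-- Normalising constant. -/
def jC (θ : ℝ) (n : ℕ) : ℝ :=
  (∏ i : Fin n, Real.Gamma θ / Real.Gamma (((i : ℕ) + 1) * θ)) *
    (∏ i : Fin n, 1 / Real.Gamma (((i : ℕ) + 1) * θ))

lemma jw_eq (θ : ℝ) {n : ℕ} (f : Fin n → ℕ) :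
    jw θ f = jC θ n * (∏ i : Fin n, ∏ j ∈ Finset.univ.filter (fun j => i < j),
      pF θ (ell θ f i - ell θ f j)) * ∏ i : Fin n, pG θ (ell θ f i + θ * n) := by
  unfold jw jackOne jackDualOne jC pF pG
  simp only [Finset.prod_mul_distrib]
  ring

lemma pF_pos {θ : ℝ} (hθ : 0 < θ) {D : ℝ} (hD : θ ≤ D) : 0 < pF θ D := by
  have h1 := Real.Gamma_pos_of_pos (show 0 < D + θ by linarith)
  have h2 := Real.Gamma_pos_of_pos (show 0 < D by linarith)
  have h3 := Real.Gamma_pos_of_pos (show 0 < D + 1 by linarith)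
  have h4 := Real.Gamma_pos_of_pos (show 0 < D + 1 - θ by linarith)
  unfold pF
  positivity

lemma pF_step {θ : ℝ} (hθ : 0 < θ) {D : ℝ} (hD : θ ≤ D) :
    pF θ (D + 1) * ((D + 1 - θ) / (D + 1)) = pF θ D * ((D + θ) / D) := by
  have h1 := Real.Gamma_pos_of_pos (show 0 < D + θ by linarith)
  have h2 := Real.Gamma_pos_of_pos (show 0 < D by linarith)
  have h3 := Real.Gamma_pos_of_pos (show 0 < D + 1 by linarith)
  have h4 := Real.Gamma_pos_of_pos (show 0 < D + 1 - θ by linarith)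
  have p1 : 0 < D + θ := by linarith
  have p2 : 0 < D := by linarith
  have p3 : 0 < D + 1 := by linarith
  have p4 : 0 < D + 1 - θ := by linarith
  unfold pF
  rw [show D + 1 + θ = (D + θ) + 1 by ring, show D + 1 + 1 - θ = (D + 1 - θ) + 1 by ring,
    Real.Gamma_add_one p1.ne', Real.Gamma_add_one p3.ne', Real.Gamma_add_one p4.ne',
    Real.Gamma_add_one p2.ne']
  field_simp

lemma pG_pos {θ : ℝ} (hθ : 0 < θ) {x : ℝ} (hx : 0 ≤ x) : 0 < pG θ x := by
  have h1 := Real.Gamma_pos_of_pos (show 0 < x + θ by linarith)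
  have h3 := Real.Gamma_pos_of_pos (show 0 < x + 1 by linarith)
  unfold pG
  positivity

lemma pG_step {θ : ℝ} (hθ : 0 < θ) {x : ℝ} (hx : 0 ≤ x) :
    pG θ (x + 1) * (x + 1) = pG θ x * (x + θ) := by
  have h1 := Real.Gamma_pos_of_pos (show 0 < x + θ by linarith)
  have h3 := Real.Gamma_pos_of_pos (show 0 < x + 1 by linarith)
  have p1 : 0 < x + θ := by linarith
  have p3 : 0 < x + 1 := by linarith
  unfold pG
  rw [show x + 1 + θ = (x + θ) + 1 by ring, Real.Gamma_add_one p1.ne', Real.Gamma_add_one p3.ne']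
  field_simp

lemma jC_pos {θ : ℝ} (hθ : 0 < θ) (n : ℕ) : 0 < jC θ n := by
  have h1 := Real.Gamma_pos_of_pos hθ
  have h : ∀ i : Fin n, 0 < Real.Gamma (((i : ℕ) + 1) * θ) := fun i =>
    Real.Gamma_pos_of_pos (by positivity)
  exact mul_pos (Finset.prod_pos fun i _ => div_pos h1 (h i))
    (Finset.prod_pos fun i _ => div_pos one_pos (h i))

lemma jW_nonneg {θ : ℝ} (hθ : 0 < θ) {n : ℕ} (f : Fin n → ℕ) : 0 ≤ jW θ f := by
  unfold jW
  split_ifs with hf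
  · rw [jw_eq]
    refine le_of_lt (mul_pos (mul_pos (jC_pos hθ n) ?_) ?_)
    · exact Finset.prod_pos fun i _ => Finset.prod_pos fun j hj =>
        pF_pos hθ (ell_gap hθ hf (Finset.mem_filter.1 hj).2)
    · exact Finset.prod_pos fun i _ => pG_pos hθ (ell_pos hθ f i)
  · exact le_rfl

lemma prod_pairs {n : ℕ} (k : Fin n) (α : Fin n → ℝ) :
    ∏ i : Fin n, ∏ j ∈ Finset.univ.filter (fun j => i < j),
      (if i = k then α j else if j = k then α i else 1) = ∏ j ∈ univ.erase k, α j := by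
  have h : ∀ i : Fin n, ∏ j ∈ Finset.univ.filter (fun j => i < j),
      (if i = k then α j else if j = k then α i else 1) =
      if i = k then ∏ j ∈ univ.filter (fun j => k < j), α j else if i < k then α i else 1 := by
    intro i
    by_cases h1 : i = k
    · subst h1; simp
    · simp only [h1, if_false]
      rw [Finset.prod_ite_eq' (univ.filter (fun j => i < j)) k (fun _ => α i)]
      simp
  rw [Finset.prod_congr rfl fun i _ => h i, ← Finset.mul_prod_erase univ _ (Finset.mem_univ k)]
  simp only [if_true]
  have h2 : ∏ i ∈ univ.erase k, (if i = k then ∏ j ∈ univ.filter (fun j => k < j), α j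
      else if i < k then α i else 1) = ∏ i ∈ univ.erase k, if i < k then α i else 1 :=
    Finset.prod_congr rfl fun i hi => by simp [(Finset.mem_erase.1 hi).1]
  have h3 : ∏ j ∈ univ.filter (fun j => k < j), α j =
      ∏ i ∈ univ.erase k, if k < i then α i else 1 := by
    rw [← Finset.prod_filter]
    refine Finset.prod_congr ?_ fun _ _ => rfl
    ext j
    simp only [Finset.mem_filter, Finset.mem_univ, true_and, Finset.mem_erase, and_true]
    exact ⟨fun h => ⟨h.ne', h⟩, fun h => h.2⟩
  rw [h2, h3, ← Finset.prod_mul_distrib]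
  refine Finset.prod_congr rfl fun i hi => ?_
  rcases lt_or_gt_of_ne (Finset.mem_erase.1 hi).1 with h | h
  · simp [h, h.not_gt]
  · simp [h, h.not_gt]

/-- Adding a box in row `k`. -/
def addBox {n : ℕ} (f : Fin n → ℕ) (k : Fin n) : Fin n → ℕ := Function.update f k (f k + 1)

lemma ell_addBox (θ : ℝ) {n : ℕ} (f : Fin n → ℕ) (k i : Fin n) :
    ell θ (addBox f k) i = ell θ f i + if i = k then 1 else 0 := by
  unfold ell addBox
  by_cases h : i = k
  · subst h; simp; ring
  · simp [h]

lemma jw_step {θ : ℝ} (hθ : 0 < θ) {n : ℕ} {f : Fin n → ℕ} {k : Fin n} (hf : Antitone f)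
    (hg : Antitone (addBox f k)) :
    jw θ (addBox f k) * dnB θ (addBox f k) k = jw θ f * upA θ f k := by
  have hb : pfc (-θ) (ell θ (addBox f k)) univ k = ∏ j ∈ univ.erase k,
      (ell θ f k - ell θ f j + 1 - θ) / (ell θ f k - ell θ f j + 1) := by
    refine Finset.prod_congr rfl fun j hj => ?_
    have hjk := (Finset.mem_erase.1 hj).1
    have h : ell θ (addBox f k) k - ell θ (addBox f k) j ≠ 0 :=
      sub_ne_zero.2 fun h => hjk (ell_inj hθ hg h).symm
    have e : ell θ (addBox f k) k - ell θ (addBox f k) j = ell θ f k - ell θ f j + 1 := by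
      rw [ell_addBox, ell_addBox]; simp [hjk]; ring
    rw [e] at h ⊢
    field_simp
    ring
  have ha : pfc θ (ell θ f) univ k = ∏ j ∈ univ.erase k,
      (ell θ f k - ell θ f j + θ) / (ell θ f k - ell θ f j) := by
    refine Finset.prod_congr rfl fun j hj => ?_
    have hjk := (Finset.mem_erase.1 hj).1
    have h : ell θ f k - ell θ f j ≠ 0 := sub_ne_zero.2 fun h => hjk (ell_inj hθ hf h).symm
    field_simp
  have hpair : (∏ i : Fin n, ∏ j ∈ Finset.univ.filter (fun j => i < j),
        pF θ (ell θ (addBox f k) i - ell θ (addBox f k) j)) *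
        pfc (-θ) (ell θ (addBox f k)) univ k =
      (∏ i : Fin n, ∏ j ∈ Finset.univ.filter (fun j => i < j),
        pF θ (ell θ f i - ell θ f j)) * pfc θ (ell θ f) univ k := by
    rw [ha, hb, ← prod_pairs k, ← prod_pairs k, ← Finset.prod_mul_distrib,
      ← Finset.prod_mul_distrib]
    refine Finset.prod_congr rfl fun i _ => ?_
    rw [← Finset.prod_mul_distrib, ← Finset.prod_mul_distrib]
    refine Finset.prod_congr rfl fun j hj => ?_
    have hij : i < j := (Finset.mem_filter.1 hj).2
    have g1 := ell_gap hθ hf hij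
    have g2 := ell_gap hθ hg hij
    by_cases h1 : i = k
    · subst h1
      have e : ell θ (addBox f i) i - ell θ (addBox f i) j = ell θ f i - ell θ f j + 1 := by
        rw [ell_addBox, ell_addBox]; simp [hij.ne']; ring
      rw [e]
      simp only [if_true]
      exact pF_step hθ g1
    · by_cases h2 : j = k
      · subst h2
        have e : ell θ f i - ell θ f j = (ell θ (addBox f j) i - ell θ (addBox f j) j) + 1 := by
          rw [ell_addBox, ell_addBox]; simp [hij.ne]; ring
        simp only [h1, if_true, if_false]
        have e2 : ell θ f j - ell θ f i = -(ell θ f i - ell θ f j) := by ring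
        rw [e2, e]
        generalize ell θ (addBox f j) i - ell θ (addBox f j) j = E at *
        have st := pF_step hθ g2
        have p1 : E ≠ 0 := by linarith
        have p2 : E + 1 ≠ 0 := by linarith
        rw [show -(E + 1) + 1 - θ = -(E + θ) by ring, show -(E + 1) + 1 = -E by ring,
          show -(E + 1) + θ = -(E + 1 - θ) by ring, neg_div_neg_eq, neg_div_neg_eq]
        exact st.symm
      · simp [h1, h2, ell_addBox]
  have hsing : (∏ i : Fin n, pG θ (ell θ (addBox f k) i + θ * n)) *
        (ell θ (addBox f k) k + θ * n) =
      (∏ i : Fin n, pG θ (ell θ f i + θ * n)) * (ell θ f k + θ * n + θ) := by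
    rw [← Finset.mul_prod_erase univ _ (Finset.mem_univ k),
      ← Finset.mul_prod_erase univ (fun i => pG θ (ell θ f i + θ * n)) (Finset.mem_univ k)]
    have : ∏ i ∈ univ.erase k, pG θ (ell θ (addBox f k) i + θ * n) =
        ∏ i ∈ univ.erase k, pG θ (ell θ f i + θ * n) :=
      Finset.prod_congr rfl fun i hi => by
        rw [ell_addBox]; simp [(Finset.mem_erase.1 hi).1]
    rw [this]
    have st := pG_step hθ (ell_pos hθ f k)
    have e : ell θ (addBox f k) k + θ * n = ell θ f k + θ * n + 1 := by
      rw [ell_addBox]; simp; ring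
    rw [e]
    linear_combination (∏ i ∈ univ.erase k, pG θ (ell θ f i + θ * n)) * st
  rw [jw_eq, jw_eq]
  unfold dnB upA
  calc _ = jC θ n * ((∏ i : Fin n, ∏ j ∈ Finset.univ.filter (fun j => i < j),
        pF θ (ell θ (addBox f k) i - ell θ (addBox f k) j)) *
        pfc (-θ) (ell θ (addBox f k)) univ k) *
        ((∏ i : Fin n, pG θ (ell θ (addBox f k) i + θ * n)) *
        (ell θ (addBox f k) k + θ * n)) := by ring
    _ = _ := by rw [hpair, hsing]; ring

/-- A tuple is antitone iff consecutive entries decrease. -/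
lemma antitone_of_consec {n : ℕ} {f : Fin n → ℕ}
    (h : ∀ i j : Fin n, (i : ℕ) + 1 = j → f j ≤ f i) : Antitone f := by
  have key : ∀ d : ℕ, ∀ i j : Fin n, (i : ℕ) + d = j → f j ≤ f i := by
    intro d
    induction d with
    | zero => intro i j hij; rw [show i = j from Fin.ext (by simpa using hij)]
    | succ d ih =>
      intro i j hij
      have hm : (i : ℕ) + d < n := by omega
      exact (h ⟨i + d, hm⟩ j (by simp; omega)).trans (ih i ⟨i + d, hm⟩ rfl)
  intro i j hij
  exact key (j - i) i j (by have : (i : ℕ) ≤ j := hij; omega)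

lemma upA_zero {θ : ℝ} (hθ : 0 < θ) {n : ℕ} {f : Fin n → ℕ} {k : Fin n} (hf : Antitone f)
    (hg : ¬ Antitone (addBox f k)) : upA θ f k = 0 := by
  have : ∃ i : Fin n, (i : ℕ) + 1 = k ∧ f i = f k := by
    by_contra hcon
    push Not at hcon
    apply hg
    apply antitone_of_consec
    intro i j hij
    have hlt : i < j := by rw [Fin.lt_def]; omega
    have h0 := hf hlt.le
    unfold addBox
    by_cases h1 : j = k
    · subst h1
      have := hcon i hij
      rw [Function.update_self, Function.update_of_ne hlt.ne]
      omega
    · rw [Function.update_of_ne h1]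
      by_cases h2 : i = k
      · subst h2; simp; omega
      · rw [Function.update_of_ne h2]; exact h0
  obtain ⟨i, hi, hfi⟩ := this
  have hik : i ≠ k := by intro h; subst h; omega
  unfold upA pfc
  rw [Finset.prod_eq_zero (i := i) (by simp [hik]), mul_zero]
  have : ell θ f k - ell θ f i = -θ := by
    unfold ell; rw [hfi, ← hi]; push_cast; ring
  rw [this, div_neg, div_self hθ.ne']; ring

lemma dnB_zero_of_eq {θ : ℝ} (hθ : 0 < θ) {n : ℕ} {f : Fin n → ℕ} {k i : Fin n}
    (hi : (k : ℕ) + 1 = i) (hfi : f i = f k) : dnB θ f k = 0 := by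
  have hik : i ≠ k := by intro h; subst h; omega
  unfold dnB pfc
  rw [Finset.prod_eq_zero (i := i) (by simp [hik]), mul_zero]
  have : ell θ f k - ell θ f i = θ := by
    unfold ell; rw [hfi, ← hi]; push_cast; ring
  rw [this, neg_div, div_self hθ.ne']; ring

lemma dnB_zero {θ : ℝ} (hθ : 0 < θ) {n : ℕ} {f : Fin n → ℕ} {k : Fin n} (hf : ¬ Antitone f)
    (hg : Antitone (addBox f k)) : dnB θ (addBox f k) k = 0 := by
  have : ∃ i : Fin n, (k : ℕ) + 1 = i ∧ addBox f k i = addBox f k k := by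
    by_contra hcon
    push Not at hcon
    apply hf
    apply antitone_of_consec
    intro i j hij
    have hlt : i < j := by rw [Fin.lt_def]; omega
    have h0 := hg hlt.le
    by_cases h1 : i = k
    · subst h1
      have h3 := hcon j hij
      unfold addBox at h0 h3
      rw [Function.update_self, Function.update_of_ne hlt.ne'] at h0 h3
      omega
    · unfold addBox at h0
      rw [Function.update_of_ne h1] at h0
      by_cases h2 : j = k
      · subst h2; simp at h0; omega
      · rwa [Function.update_of_ne h2] at h0
  obtain ⟨i, hi, hfi⟩ := this
  exact dnB_zero_of_eq hθ hi hfi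

lemma dnB_zero_of_zero {θ : ℝ} (hθ : 0 < θ) {n : ℕ} {f : Fin n → ℕ} {k : Fin n}
    (hf : Antitone f) (hk : f k = 0) : dnB θ f k = 0 := by
  by_cases h : (k : ℕ) + 1 < n
  · refine dnB_zero_of_eq hθ (i := ⟨k + 1, h⟩) rfl ?_
    have : f ⟨k + 1, h⟩ ≤ f k := hf (by rw [Fin.le_def]; simp)
    omega
  · have hn : (n : ℝ) = (k : ℕ) + 1 := by
      have : n = k + 1 := by omega
      exact_mod_cast this
    unfold dnB ell
    rw [hk, hn]
    push_cast
    ring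

lemma jW_step {θ : ℝ} (hθ : 0 < θ) {n : ℕ} (f : Fin n → ℕ) (k : Fin n) :
    jW θ (addBox f k) * dnB θ (addBox f k) k = jW θ f * upA θ f k := by
  unfold jW
  by_cases hf : Antitone f <;> by_cases hg : Antitone (addBox f k)
  · simp only [hf, hg, if_true]; exact jw_step hθ hf hg
  · simp [hf, hg, upA_zero hθ hf hg]
  · simp [hf, hg, dnB_zero hθ hf hg]
  · simp [hf, hg]

/-- Coefficient of `q ^ m`. -/
def jA (θ : ℝ) (n m : ℕ) : ℝ := ∑ f ∈ Finset.piAntidiag (univ : Finset (Fin n)) m, jW θ f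

lemma jA_step {θ : ℝ} (hθ : 0 < θ) (n m : ℕ) :
    ((m : ℝ) + 1) * jA θ n (m + 1) = (m + θ * (n : ℝ) ^ 2) * jA θ n m := by
  have hL : ((m : ℝ) + 1) * jA θ n (m + 1) =
      ∑ k : Fin n, ∑ f ∈ Finset.piAntidiag (univ : Finset (Fin n)) (m + 1),
        jW θ f * dnB θ f k := by
    rw [Finset.sum_comm, jA, Finset.mul_sum]
    refine Finset.sum_congr rfl fun f hf => ?_
    rw [← Finset.mul_sum]
    by_cases h : Antitone f
    · rw [dnB_sum hθ h, (Finset.mem_piAntidiag.1 hf).1]; push_cast; ring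
    · simp [jW, h]
  have hR : (m + θ * (n : ℝ) ^ 2) * jA θ n m =
      ∑ k : Fin n, ∑ f ∈ Finset.piAntidiag (univ : Finset (Fin n)) m,
        jW θ f * upA θ f k := by
    rw [Finset.sum_comm, jA, Finset.mul_sum]
    refine Finset.sum_congr rfl fun f hf => ?_
    rw [← Finset.mul_sum]
    by_cases h : Antitone f
    · rw [upA_sum hθ h, (Finset.mem_piAntidiag.1 hf).1]; ring
    · simp [jW, h]
  rw [hL, hR]
  refine Finset.sum_congr rfl fun k _ => ?_
  symm
  have hsum : ∀ f : Fin n → ℕ, ∑ i, addBox f k i = ∑ i, f i + 1 := by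
    intro f
    unfold addBox
    rw [Finset.sum_update_of_mem (Finset.mem_univ k),
      ← Finset.add_sum_erase univ f (Finset.mem_univ k), Finset.sdiff_singleton_eq_erase]
    ring
  have hinj : ∀ f g : Fin n → ℕ, addBox f k = addBox g k → f = g := by
    intro f g h
    funext i
    have := congrFun h i
    unfold addBox at this
    by_cases hi : i = k
    · subst hi; simpa using this
    · simpa [hi] using this
  rw [Finset.sum_congr rfl fun f _ => (jW_step hθ f k).symm]
  rw [← Finset.sum_image (f := fun g => jW θ g * dnB θ g k) (g := fun f => addBox f k)
    (fun f _ g _ h => hinj f g h)]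
  refine Finset.sum_subset ?_ ?_
  · intro g hg
    obtain ⟨f, hf, rfl⟩ := Finset.mem_image.1 hg
    simp only [Finset.mem_piAntidiag, Finset.mem_univ, implies_true, and_true] at hf ⊢
    rw [hsum, hf]
  · intro g hg hng
    simp only [Finset.mem_piAntidiag, Finset.mem_univ, implies_true, and_true] at hg
    by_cases h : Antitone g
    · have hk : g k = 0 := by
        by_contra hk
        apply hng
        have hgg : addBox (Function.update g k (g k - 1)) k = g := by
          unfold addBox
          funext i
          by_cases hi : i = k
          · subst hi; simp; omega
          · simp [hi]
        refine Finset.mem_image.2 ⟨Function.update g k (g k - 1), ?_, hgg⟩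
        simp only [Finset.mem_piAntidiag, Finset.mem_univ, implies_true, and_true]
        have := hsum (Function.update g k (g k - 1))
        rw [hgg, hg] at this
        exact (Nat.succ_injective this).symm
      rw [dnB_zero_of_zero hθ h hk, mul_zero]
    · simp [jW, h]

lemma prod_tele (g : ℕ → ℝ) (hg : ∀ m, g m ≠ 0) (n : ℕ) (i : Fin n) :
    ∏ j ∈ Finset.univ.filter (fun j : Fin n => i < j), g ((j : ℕ) - i) / g ((j : ℕ) - i - 1) =
      g (n - 1 - i) / g 0 := by
  have key : ∀ (a m : ℕ), ∏ j ∈ Finset.range m,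
      (if a < j then g (j - a) / g (j - a - 1) else 1) = g (m - 1 - a) / g 0 := by
    intro a m
    induction m with
    | zero => simp [hg 0]
    | succ m ih =>
      rw [Finset.prod_range_succ, ih]
      by_cases h : a < m
      · have h1 := hg (m - 1 - a)
        have h0 := hg 0
        rw [if_pos h, show m - a - 1 = m - 1 - a by omega, show m + 1 - 1 - a = m - a by omega]
        field_simp
      · rw [if_neg h, show m - 1 - a = 0 by omega, show m + 1 - 1 - a = 0 by omega, mul_one]
  rw [Finset.prod_filter, ← key i n, ← Fin.prod_univ_eq_prod_range
    (fun j => if (i : ℕ) < j then g (j - i) / g (j - i - 1) else 1) n]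
  rfl

lemma jA_zero {θ : ℝ} (hθ : 0 < θ) (n : ℕ) : jA θ n 0 = 1 := by
  have h0 : Antitone (0 : Fin n → ℕ) := fun _ _ _ => le_rfl
  have : jA θ n 0 = jw θ (0 : Fin n → ℕ) := by
    simp [jA, jW, h0]
  rw [this, jw_eq]
  have hG : ∀ m : ℕ, Real.Gamma (((m : ℝ) + 1) * θ) ≠ 0 := fun m =>
    (Real.Gamma_pos_of_pos (by positivity)).ne'
  have hG1 : ∀ m : ℕ, Real.Gamma ((m : ℝ) * θ + 1) ≠ 0 := fun m =>
    (Real.Gamma_pos_of_pos (by positivity)).ne'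
  have hpair : ∀ i : Fin n, ∏ j ∈ Finset.univ.filter (fun j => i < j),
      pF θ (ell θ (0 : Fin n → ℕ) i - ell θ (0 : Fin n → ℕ) j) =
      (Real.Gamma ((((n - 1 - i : ℕ) : ℝ) + 1) * θ) / Real.Gamma θ) *
      Real.Gamma (((n - 1 - i : ℕ) : ℝ) * θ + 1) := by
    intro i
    have t1 := prod_tele (fun m => Real.Gamma (((m : ℝ) + 1) * θ)) hG n i
    have t2 := prod_tele (fun m => Real.Gamma ((m : ℝ) * θ + 1)) hG1 n i
    simp only [Nat.cast_zero, zero_add, one_mul, zero_mul, Real.Gamma_one, div_one] at t1 t2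
    rw [← t1, ← t2, ← Finset.prod_mul_distrib]
    refine Finset.prod_congr rfl fun j hj => ?_
    have hij : (i : ℕ) < j := (Finset.mem_filter.1 hj).2
    have e1 : (((j : ℕ) - i : ℕ) : ℝ) = (j : ℕ) - (i : ℕ) := by
      rw [Nat.cast_sub hij.le]
    have e2 : (((j : ℕ) - i - 1 : ℕ) : ℝ) = (j : ℕ) - (i : ℕ) - 1 := by
      rw [Nat.cast_sub (by omega), e1]; simp
    rw [e1, e2]
    unfold pF ell
    simp only [Pi.zero_apply, Nat.cast_zero]
    congr 3 <;> ring_nf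
  have hsing : ∀ i : Fin n, pG θ (ell θ (0 : Fin n → ℕ) i + θ * n) =
      Real.Gamma ((((n - 1 - i : ℕ) : ℝ) + 1) * θ) /
      Real.Gamma (((n - 1 - i : ℕ) : ℝ) * θ + 1) := by
    intro i
    have e : ((n - 1 - i : ℕ) : ℝ) = (n : ℝ) - 1 - (i : ℕ) := by
      have hi := i.2
      rw [Nat.cast_sub (show (i : ℕ) ≤ n - 1 by omega), Nat.cast_sub (show 1 ≤ n by omega)]; simp
    rw [e]
    unfold pG ell
    simp only [Pi.zero_apply, Nat.cast_zero]
    congr 2 <;> ring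
  have hrefl : ∏ i : Fin n, Real.Gamma ((((n - 1 - i : ℕ) : ℝ) + 1) * θ) =
      ∏ i : Fin n, Real.Gamma ((((i : ℕ) : ℝ) + 1) * θ) := by
    rw [← Equiv.prod_comp Fin.revPerm]
    refine Finset.prod_congr rfl fun i _ => ?_
    have : n - 1 - ((Fin.revPerm i : Fin n) : ℕ) = i := by
      rw [Fin.revPerm_apply, Fin.val_rev]; have := i.2; omega
    rw [this]
  have hθG := (Real.Gamma_pos_of_pos hθ).ne'
  have hne : ∏ i : Fin n, Real.Gamma ((((i : ℕ) : ℝ) + 1) * θ) ≠ 0 :=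
    Finset.prod_ne_zero_iff.2 fun i _ => hG i
  have hne1 : ∏ i : Fin n, Real.Gamma (((n - 1 - i : ℕ) : ℝ) * θ + 1) ≠ 0 :=
    Finset.prod_ne_zero_iff.2 fun i _ => hG1 _
  rw [Finset.prod_congr rfl fun i _ => hpair i, Finset.prod_congr rfl fun i _ => hsing i]
  unfold jC
  simp only [Finset.prod_mul_distrib, Finset.prod_div_distrib, hrefl, Finset.prod_const,
    Finset.card_univ, Fintype.card_fin, one_pow]
  generalize ∏ i : Fin n, Real.Gamma ((((i : ℕ) : ℝ) + 1) * θ) = P at *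
  generalize ∏ i : Fin n, Real.Gamma (((n - 1 - i : ℕ) : ℝ) * θ + 1) = Q at *
  field_simp

lemma jA_eq {θ : ℝ} (hθ : 0 < θ) (n m : ℕ) :
    jA θ n m = Ring.choose (θ * (n : ℝ) ^ 2 + m - 1) m := by
  set a := θ * (n : ℝ) ^ 2 with ha
  have h1 : Ring.choose (a + m - 1) m = Ring.multichoose a m := by
    rw [Ring.choose]; congr 1; ring
  rw [h1]
  have h2 := fun m => Ring.factorial_nsmul_multichoose_eq_ascPochhammer a m
  have hm : ∀ m : ℕ, (m.factorial : ℝ) * Ring.multichoose a m = (ascPochhammer ℝ m).eval a := by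
    intro m
    rw [← nsmul_eq_mul, h2, Polynomial.ascPochhammer_smeval_eq_eval]
  have h3 : (m.factorial : ℝ) * jA θ n m = (ascPochhammer ℝ m).eval a := by
    induction m with
    | zero => simp [jA_zero hθ]
    | succ m ih =>
      rw [ascPochhammer_succ_eval, ← ih (by rw [Ring.choose]; congr 1; ring)]
      have := jA_step hθ n m
      rw [Nat.factorial_succ]
      push_cast
      linear_combination (m.factorial : ℝ) * this
  rw [← hm] at h3
  exact mul_left_cancel₀ (by positivity) h3

lemma jA_hasSum {θ : ℝ} (hθ : 0 < θ) (n : ℕ) (q : ℝ) (hq0 : 0 ≤ q) (hq1 : q < 1) :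
    HasSum (fun m => jA θ n m * q ^ m) ((1 - q) ^ (-(θ * (n : ℝ) ^ 2))) := by
  have h := (Real.one_div_one_sub_rpow_hasFPowerSeriesOnBall_zero (θ * (n : ℝ) ^ 2)).hasSum
    (y := q) (by
      rw [Metric.mem_eball, edist_zero_right]
      rw [← ofReal_norm, Real.norm_of_nonneg hq0]
      exact ENNReal.ofReal_lt_one.2 hq1)
  rw [zero_add, one_div, ← Real.rpow_neg (by linarith)] at h
  have e : (fun m => jA θ n m * q ^ m) = fun m => (FormalMultilinearSeries.ofScalars ℝ
      (fun k : ℕ => Ring.choose (θ * (n : ℝ) ^ 2 + k - 1) k) m) fun _ => q := by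
    funext m
    rw [jA_eq hθ, FormalMultilinearSeries.ofScalars_apply_eq]
    simp
  rw [e]
  exact h

lemma jW_hasSum {θ : ℝ} (hθ : 0 < θ) (n : ℕ) (q : ℝ) (hq0 : 0 ≤ q) (hq1 : q < 1) :
    HasSum (fun f : Fin n → ℕ => jW θ f * q ^ (∑ i, f i))
      ((1 - q) ^ (-(θ * (n : ℝ) ^ 2))) := by
  have hA := jA_hasSum hθ n q hq0 hq1
  rw [← (Equiv.sigmaFiberEquiv (fun f : Fin n → ℕ => ∑ i, f i)).hasSum_iff]
  have hfib : ∀ m : ℕ, HasSum (fun f : {f : Fin n → ℕ // ∑ i, f i = m} =>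
      jW θ f.1 * q ^ (∑ i, f.1 i)) (jA θ n m * q ^ m) := by
    intro m
    have hset : {f : Fin n → ℕ | ∑ i, f i = m} =
        ↑(Finset.piAntidiag (univ : Finset (Fin n)) m) := by
      ext f; simp
    have h1 : HasSum ((fun f : Fin n → ℕ => jW θ f * q ^ (∑ i, f i)) ∘
        ((↑) : {f : Fin n → ℕ | ∑ i, f i = m} → (Fin n → ℕ)))
        (∑ f ∈ Finset.piAntidiag (univ : Finset (Fin n)) m, jW θ f * q ^ (∑ i, f i)) := by
      rw [hset]
      exact Finset.hasSum _ _
    have h2 : ∑ f ∈ Finset.piAntidiag (univ : Finset (Fin n)) m, jW θ f * q ^ (∑ i, f i) =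
        jA θ n m * q ^ m := by
      rw [jA, Finset.sum_mul]
      exact Finset.sum_congr rfl fun f hf => by rw [(Finset.mem_piAntidiag.1 hf).1]
    rw [← h2]
    exact h1
  have hs : Summable ((fun f : Fin n → ℕ => jW θ f * q ^ (∑ i, f i)) ∘
      (Equiv.sigmaFiberEquiv (fun f : Fin n → ℕ => ∑ i, f i))) := by
    refine (summable_sigma_of_nonneg ?_).2 ⟨fun m => (hfib m).summable, ?_⟩
    · intro x
      exact mul_nonneg (jW_nonneg hθ _) (pow_nonneg hq0 _)
    · refine hA.summable.congr fun m => ?_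
      exact (hfib m).tsum_eq.symm
  have := hs.hasSum.sigma hfib
  rw [hA.unique this]
  exact hs.hasSum

/-- Cauchy identity specialization: for `θ > 0` and `q ∈ [0,1)`,
`∑_λ (∏ᵢ q^{λᵢ}) J_λ(1^N) Ĵ_λ(1^N) = (1−q)^{−θN²}`, summed over all partitions
`λ₁ ≥ ⋯ ≥ λ_N ≥ 0` with integer parts. -/
theorem jack_cauchy_identity (θ : ℝ) (hθ : 0 < θ) (N : ℕ) (q : ℝ)
    (hq0 : 0 ≤ q) (hq1 : q < 1) :
    ∑' lam : {f : Fin N → ℕ // Antitone f},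
        (∏ i : Fin N, q ^ (lam.1 i)) * jackOne θ lam.1 * jackDualOne θ lam.1 =
      (1 - q) ^ (-(θ * (N : ℝ) ^ 2)) := by
  rw [← (jW_hasSum hθ N q hq0 hq1).tsum_eq]
  have h := tsum_subtype {f : Fin N → ℕ | Antitone f}
    (fun f => (∏ i : Fin N, q ^ (f i)) * jackOne θ f * jackDualOne θ f)
  refine h.trans (tsum_congr fun f => ?_)
  by_cases hf : Antitone f
  · rw [Set.indicator_of_mem (by exact hf), Finset.prod_pow_eq_pow_sum, jW, if_pos hf, jw]
    ring
  · rw [Set.indicator_of_notMem (by exact hf), jW, if_neg hf, zero_mul]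

end
end

section
/- Let θ > 0 and consider partitions λ^j interlacing as λ^j ⪰ λ^{j−1}, with ℓ^j_i = λ^j_i − iθ. Fix s ∈ ℝ, indices i and k ≤ j₂ ≤ j₁ ≤ N with ℓ^{j₂}_i = ⋯ = ℓ^{j₁}_i = s, and suppose that the configuration ℓ̃ obtained by decreasing ℓ^j_i by 1 for all j₂ ≤ j ≤ j₁ remains an interlacing configuration in 𝔛^{θ,M}_{N,k}. Then for k+1 ≤ j₂ ≤ j₁ ≤ N−1, the ratio ℙ^{θ,M}_{N,k}(ℓ̃)/ℙ^{θ,M}_{N,k}(ℓ) equals ∏_{j=j₂}^{j₁} w_j(s−1)/w_j(s) · ∏_{p≠i, p≤j₁} (s−ℓ^{j₁}_p+θ−1)/(s−ℓ^{j₁}_p) · ∏_{p≠i, p≤j₂} (s−ℓ^{j₂}_p−1)/(s−ℓ^{j₂}_p−θ) · ∏_{p=1}^{j₂−1} (s−ℓ^{j₂−1}_p)/(s−ℓ^{j₂−1}_p+θ−1) · ∏_{p=1}^{j₁+1} (s−ℓ^{j₁+1}_p−θ)/(s−ℓ^{j₁+1}_p−1). -/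
open Finset

noncomputable section

/-- `H^t(ℓ^N)` of (2.3): `∏_{p<q} Γ(ℓ_p−ℓ_q+1)/Γ(ℓ_p−ℓ_q+1−θ) · ∏_p w_N(ℓ_p)`,
with a complex-valued weight `w`. -/
def HtC (θ : ℝ) (w : ℝ → ℂ) {n : ℕ} (lam : Fin n → ℕ) : ℂ :=
  ((∏ p : Fin n, ∏ q ∈ Finset.univ.filter (fun q => p < q),
      Real.Gamma (ell θ lam p - ell θ lam q + 1) /
        Real.Gamma (ell θ lam p - ell θ lam q + 1 - θ) : ℝ) : ℂ) *
    ∏ p : Fin n, w (ell θ lam p)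

/-- `H^b(ℓ^k)` of (2.3): `∏_{p<q} Γ(ℓ_p−ℓ_q+θ)/Γ(ℓ_p−ℓ_q)`. -/
def HbC (θ : ℝ) {n : ℕ} (lam : Fin n → ℕ) : ℂ :=
  ((∏ p : Fin n, ∏ q ∈ Finset.univ.filter (fun q => p < q),
      Real.Gamma (ell θ lam p - ell θ lam q + θ) /
        Real.Gamma (ell θ lam p - ell θ lam q) : ℝ) : ℂ)

/-- The interlacing kernel `I(ℓ^{j+1}, ℓ^j)` of (2.2), including the level weight
`∏_p w_j(ℓ^j_p)` with complex-valued weight `w`. -/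
def IkernelC (θ : ℝ) (w : ℝ → ℂ) {n : ℕ} (lamU : Fin (n + 1) → ℕ)
    (lamL : Fin n → ℕ) : ℂ :=
  (((∏ p : Fin (n + 1), ∏ q ∈ Finset.univ.filter (fun q => p < q),
      Real.Gamma (ell θ lamU p - ell θ lamU q + 1 - θ) /
        Real.Gamma (ell θ lamU p - ell θ lamU q)) *
    (∏ p : Fin n, ∏ q ∈ Finset.univ.filter (fun q => p < q),
      Real.Gamma (ell θ lamL p - ell θ lamL q + 1) /
        Real.Gamma (ell θ lamL p - ell θ lamL q + θ)) *
    (∏ p : Fin n, ∏ q ∈ (Finset.univ : Finset (Fin (n + 1))).filter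
          (fun q : Fin (n + 1) => (p : ℕ) < (q : ℕ)),
      Real.Gamma (ell θ lamL p - ell θ lamU q) /
        Real.Gamma (ell θ lamL p - ell θ lamU q + 1 - θ)) *
    (∏ p : Fin n, ∏ q ∈ Finset.univ.filter (fun q => p ≤ q),
      Real.Gamma (ell θ lamU p.castSucc - ell θ lamL q + θ) /
        Real.Gamma (ell θ lamU p.castSucc - ell θ lamL q + 1)) : ℝ) : ℂ) *
    ∏ p : Fin n, w (ell θ lamL p)

/-- A configuration `(λ^N, …, λ^k)` with `k = c+1`, `N = c+1+d`: row `r : Fin (d+1)`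
is the signature at level `k + r`, i.e. it has `c+1+r` parts; all parts lie in
`[0, M]`, rows are weakly decreasing and consecutive rows interlace. -/
def ValidConfig (M c d : ℕ)
    (A : ∀ r : Fin (d + 1), Fin (c + 1 + (r : ℕ)) → ℕ) : Prop :=
  (∀ r, Antitone (A r)) ∧ (∀ r i, A r i ≤ M) ∧
    ∀ r : Fin d, ∀ i : Fin (c + 1 + (r : ℕ)),
      A r.castSucc i ≤ A r.succ i.castSucc ∧ A r.succ i.succ ≤ A r.castSucc i

/-- The total weight `H^t(ℓ^N)·H^b(ℓ^k)·∏_{j=k}^{N−1} I(ℓ^{j+1},ℓ^j)` of (2.1),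
with level weights `w j` (the weight attached to level `j`). -/
def Wtotal (θ : ℝ) (w : ℕ → ℝ → ℂ) (c d : ℕ)
    (A : ∀ r : Fin (d + 1), Fin (c + 1 + (r : ℕ)) → ℕ) : ℂ :=
  HtC θ (w (c + 1 + d)) (A ⟨d, Nat.lt_succ_self d⟩) *
    HbC θ (A ⟨0, Nat.succ_pos d⟩) *
    ∏ j : Fin d, IkernelC θ (w (c + 1 + (j : ℕ))) (A j.succ) (A j.castSucc)


lemma gam_up (a b : ℝ) (ha : 0 < a) (hb : 0 < b) :
    Real.Gamma (a + 1) / Real.Gamma (b + 1) = Real.Gamma a / Real.Gamma b * (a / b) := by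
  rw [Real.Gamma_add_one ha.ne', Real.Gamma_add_one hb.ne']
  have := (Real.Gamma_pos_of_pos hb).ne'
  field_simp

lemma gam_down (a b : ℝ) (ha : 0 < a) (hb : 0 < b) :
    Real.Gamma a / Real.Gamma b = Real.Gamma (a + 1) / Real.Gamma (b + 1) * (b / a) := by
  rw [gam_up a b ha hb]
  field_simp

lemma gam_up' (a b a' b' r : ℝ) (ha : 0 < a) (hb : 0 < b) (ha' : a' = a + 1) (hb' : b' = b + 1)
    (hr : r = a / b) :
    Real.Gamma a' / Real.Gamma b' = Real.Gamma a / Real.Gamma b * r := by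
  subst ha' hb' hr; exact gam_up a b ha hb

lemma gam_down' (a b a' b' r : ℝ) (ha : 0 < a) (hb : 0 < b) (ha' : a' = a + 1) (hb' : b' = b + 1)
    (hr : r = b / a) :
    Real.Gamma a / Real.Gamma b = Real.Gamma a' / Real.Gamma b' * r := by
  subst ha' hb' hr; exact gam_down a b ha hb

lemma prod_shift {ι κ : Type*} [Fintype ι] [Fintype κ] [DecidableEq ι] [DecidableEq κ]
    (R : ι → κ → Prop) [∀ p q, Decidable (R p q)] (F F' : ι → κ → ℝ)
    (P : ι → Prop) (T : κ → Prop) [DecidablePred P] [DecidablePred T] (a : κ → ℝ) (b : ι → ℝ)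
    (h : ∀ p q, R p q → F' p q = F p q * ((if P p then a q else 1) * (if T q then b p else 1))) :
    ∏ p, ∏ q ∈ univ.filter (fun q => R p q), F' p q =
      (∏ p, ∏ q ∈ univ.filter (fun q => R p q), F p q) *
        ((∏ q, ∏ p, if P p then (if R p q then a q else 1) else 1) *
         (∏ p, ∏ q, if T q then (if R p q then b p else 1) else 1)) := by
  rw [prod_comm (s := (univ : Finset κ)), ← prod_mul_distrib, ← prod_mul_distrib]
  refine prod_congr rfl fun p _ => ?_
  rw [prod_filter, prod_filter, ← prod_mul_distrib, ← prod_mul_distrib]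
  refine prod_congr rfl fun q _ => ?_
  by_cases hr : R p q
  · simp [hr, h p q hr]
  · simp [hr]

def KR (θ : ℝ) {n : ℕ} (u : Fin (n + 1) → ℝ) (l : Fin n → ℝ) : ℝ :=
  ((∏ p : Fin (n + 1), ∏ q ∈ Finset.univ.filter (fun q => p < q),
      Real.Gamma (u p - u q + 1 - θ) /
        Real.Gamma (u p - u q)) *
    (∏ p : Fin n, ∏ q ∈ Finset.univ.filter (fun q => p < q),
      Real.Gamma (l p - l q + 1) /
        Real.Gamma (l p - l q + θ)) *
    (∏ p : Fin n, ∏ q ∈ (Finset.univ : Finset (Fin (n + 1))).filter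
          (fun q : Fin (n + 1) => (p : ℕ) < (q : ℕ)),
      Real.Gamma (l p - u q) /
        Real.Gamma (l p - u q + 1 - θ)) *
    (∏ p : Fin n, ∏ q ∈ Finset.univ.filter (fun q => p ≤ q),
      Real.Gamma (u p.castSucc - l q + θ) /
        Real.Gamma (u p.castSucc - l q + 1)))

lemma IkernelC_eq (θ : ℝ) (w : ℝ → ℂ) {n : ℕ} (lamU : Fin (n + 1) → ℕ) (lamL : Fin n → ℕ) :
    IkernelC θ w lamU lamL =
      ((KR θ (ell θ lamU) (ell θ lamL) : ℝ) : ℂ) * ∏ p : Fin n, w (ell θ lamL p) := rfl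

/-- gap conditions between two rows -/
structure Gap (θ : ℝ) {n : ℕ} (u : Fin (n + 1) → ℝ) (l : Fin n → ℝ) : Prop where
  uu : ∀ p q, p < q → θ ≤ u p - u q
  ll : ∀ p q, p < q → θ ≤ l p - l q
  lu : ∀ (p : Fin n) (q : Fin (n + 1)), (p : ℕ) < (q : ℕ) → θ ≤ l p - u q
  ul : ∀ p q : Fin n, p ≤ q → 0 ≤ u p.castSucc - l q

lemma KR_pos {θ : ℝ} (hθ : 0 < θ) {n : ℕ} {u : Fin (n + 1) → ℝ} {l : Fin n → ℝ}
    (h : Gap θ u l) : 0 < KR θ u l := by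
  unfold KR
  refine mul_pos (mul_pos (mul_pos ?_ ?_) ?_) ?_ <;>
    refine prod_pos fun p _ => prod_pos fun q hq => ?_ <;>
    simp only [mem_filter, mem_univ, true_and] at hq
  · have := h.uu p q hq
    exact div_pos (Real.Gamma_pos_of_pos (by linarith)) (Real.Gamma_pos_of_pos (by linarith))
  · have := h.ll p q hq
    exact div_pos (Real.Gamma_pos_of_pos (by linarith)) (Real.Gamma_pos_of_pos (by linarith))
  · have := h.lu p q hq
    exact div_pos (Real.Gamma_pos_of_pos (by linarith)) (Real.Gamma_pos_of_pos (by linarith))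
  · have := h.ul p q hq
    exact div_pos (Real.Gamma_pos_of_pos (by linarith)) (Real.Gamma_pos_of_pos (by linarith))

lemma div_neg_eq (a b c d : ℝ) (h1 : a = -c) (h2 : b = -d) : a / b = c / d := by
  rw [h1, h2, neg_div_neg_eq]

/-- shift in the lower row -/
lemma KR_lower {θ : ℝ} (hθ : 0 < θ) {n : ℕ} {u : Fin (n + 1) → ℝ} {l l' : Fin n → ℝ}
    (h : Gap θ u l) (h' : Gap θ u l') (i : Fin n) (s : ℝ) (hs : l i = s) (hi : l' i = s - 1)
    (hne : ∀ p, p ≠ i → l' p = l p) :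
    KR θ u l' = KR θ u l *
      (((∏ q, if i < q then (s - l q + θ - 1) / (s - l q) else 1) *
        (∏ p, if p < i then (s - l p - 1) / (s - l p - θ) else 1)) *
        ∏ p, (s - u p - θ) / (s - u p - 1)) := by
  have e2 := prod_shift (fun p q : Fin n => p < q)
    (fun p q => Real.Gamma (l p - l q + 1) / Real.Gamma (l p - l q + θ))
    (fun p q => Real.Gamma (l' p - l' q + 1) / Real.Gamma (l' p - l' q + θ))
    (fun p => p = i) (fun q => q = i)
    (fun q => (s - l q + θ - 1) / (s - l q)) (fun p => (s - l p - 1) / (s - l p - θ)) (by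
      intro p q hpq
      have g := h.ll p q hpq
      have g' := h'.ll p q hpq
      by_cases hp : p = i
      · subst hp
        have hq : q ≠ p := hpq.ne'
        rw [hne q hq, hi] at g'
        simp only [hq, if_true, if_false, mul_one, hne q hq, hi, hs]
        refine gam_down' _ _ _ _ _ ?_ ?_ ?_ ?_ ?_ <;> first | linarith | skip
        congr 1 <;> ring
      · by_cases hq : q = i
        · subst hq
          simp only [hp, if_true, if_false, one_mul, hne p hp, hi, hs]
          rw [hs] at g
          refine gam_up' _ _ _ _ _ ?_ ?_ ?_ ?_ ?_ <;> first | linarith | skip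
          apply div_neg_eq <;> ring
        · simp [hp, hq, hne])
  have e3 := prod_shift (fun (p : Fin n) (q : Fin (n+1)) => (p : ℕ) < (q : ℕ))
    (fun p q => Real.Gamma (l p - u q) / Real.Gamma (l p - u q + 1 - θ))
    (fun p q => Real.Gamma (l' p - u q) / Real.Gamma (l' p - u q + 1 - θ))
    (fun p => p = i) (fun q => False)
    (fun q => (s - u q - θ) / (s - u q - 1)) (fun p => 1) (by
      intro p q hpq
      have g := h.lu p q hpq
      have g' := h'.lu p q hpq
      by_cases hp : p = i
      · subst hp
        rw [hi] at g'
        simp only [if_true, if_false, mul_one, hi, hs]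
        refine gam_down' _ _ _ _ _ ?_ ?_ ?_ ?_ ?_ <;> first | linarith | skip
        congr 1 <;> ring
      · simp [hp, hne])
  have e4 := prod_shift (fun (p : Fin n) (q : Fin n) => p ≤ q)
    (fun p q => Real.Gamma (u p.castSucc - l q + θ) / Real.Gamma (u p.castSucc - l q + 1))
    (fun p q => Real.Gamma (u p.castSucc - l' q + θ) / Real.Gamma (u p.castSucc - l' q + 1))
    (fun p => False) (fun q => q = i)
    (fun q => 1) (fun p => (s - u p.castSucc - θ) / (s - u p.castSucc - 1)) (by
      intro p q hpq
      have g := h.ul p q hpq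
      by_cases hq : q = i
      · subst hq
        rw [hs] at g
        simp only [if_true, if_false, one_mul, hi, hs]
        refine gam_up' _ _ _ _ _ ?_ ?_ ?_ ?_ ?_ <;> first | linarith | skip
        apply div_neg_eq <;> ring
      · simp [hq, hne])
  have e5 : ∏ p, (s - u p - θ) / (s - u p - 1) =
      (∏ q : Fin (n+1), if (i:ℕ) < (q:ℕ) then (s - u q - θ) / (s - u q - 1) else 1) *
      (∏ p : Fin n, if p ≤ i then (s - u p.castSucc - θ) / (s - u p.castSucc - 1) else 1) := by
    have : (∏ p : Fin n, if p ≤ i then (s - u p.castSucc - θ) / (s - u p.castSucc - 1) else 1) =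
      ∏ p : Fin (n+1), if (p:ℕ) ≤ (i:ℕ) then (s - u p - θ) / (s - u p - 1) else 1 := by
      rw [Fin.prod_univ_castSucc]
      have : ¬ (n ≤ (i:ℕ)) := by omega
      simp [this]
    rw [this, ← prod_mul_distrib]
    refine prod_congr rfl fun q _ => ?_
    by_cases hq : (i:ℕ) < (q:ℕ)
    · simp [hq]
    · simp [hq, not_lt.mp hq]
  unfold KR
  rw [e2, e3, e4, e5]
  simp only [prod_ite_eq', mem_univ, if_true, if_false, prod_const_one, one_mul, mul_one]
  ring

/-- shift in the upper row -/
lemma KR_upper {θ : ℝ} (hθ : 0 < θ) {n : ℕ} {u u' : Fin (n + 1) → ℝ} {l : Fin n → ℝ}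
    (h : Gap θ u l) (h' : Gap θ u' l) (i : Fin (n + 1)) (s : ℝ) (hs : u i = s) (hi : u' i = s - 1)
    (hne : ∀ p, p ≠ i → u' p = u p) :
    KR θ u' l = KR θ u l *
      (((∏ q, if i < q then (s - u q - 1) / (s - u q - θ) else 1) *
        (∏ p, if p < i then (s - u p + θ - 1) / (s - u p) else 1)) *
        ∏ p, (s - l p) / (s - l p + θ - 1)) := by
  have e1 := prod_shift (fun p q : Fin (n+1) => p < q)
    (fun p q => Real.Gamma (u p - u q + 1 - θ) / Real.Gamma (u p - u q))
    (fun p q => Real.Gamma (u' p - u' q + 1 - θ) / Real.Gamma (u' p - u' q))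
    (fun p => p = i) (fun q => q = i)
    (fun q => (s - u q - 1) / (s - u q - θ)) (fun p => (s - u p + θ - 1) / (s - u p)) (by
      intro p q hpq
      have g := h.uu p q hpq
      have g' := h'.uu p q hpq
      by_cases hp : p = i
      · subst hp
        have hq : q ≠ p := hpq.ne'
        rw [hne q hq, hi] at g'
        simp only [hq, if_true, if_false, mul_one, hne q hq, hi, hs]
        refine gam_down' _ _ _ _ _ ?_ ?_ ?_ ?_ ?_ <;> first | linarith | skip
        congr 1 <;> ring
      · by_cases hq : q = i
        · subst hq
          simp only [hp, if_true, if_false, one_mul, hne p hp, hi, hs]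
          rw [hs] at g
          refine gam_up' _ _ _ _ _ ?_ ?_ ?_ ?_ ?_ <;> first | linarith | skip
          apply div_neg_eq <;> ring
        · simp [hp, hq, hne])
  have e3 := prod_shift (fun (p : Fin n) (q : Fin (n+1)) => (p : ℕ) < (q : ℕ))
    (fun p q => Real.Gamma (l p - u q) / Real.Gamma (l p - u q + 1 - θ))
    (fun p q => Real.Gamma (l p - u' q) / Real.Gamma (l p - u' q + 1 - θ))
    (fun p => False) (fun q => q = i)
    (fun q => 1) (fun p => (s - l p) / (s - l p + θ - 1)) (by
      intro p q hpq
      have g := h.lu p q hpq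
      by_cases hq : q = i
      · subst hq
        rw [hs] at g
        simp only [if_true, if_false, one_mul, hi, hs]
        refine gam_up' _ _ _ _ _ ?_ ?_ ?_ ?_ ?_ <;> first | linarith | skip
        apply div_neg_eq <;> ring
      · simp [hq, hne])
  have e4 := prod_shift (fun (p : Fin n) (q : Fin n) => p ≤ q)
    (fun p q => Real.Gamma (u p.castSucc - l q + θ) / Real.Gamma (u p.castSucc - l q + 1))
    (fun p q => Real.Gamma (u' p.castSucc - l q + θ) / Real.Gamma (u' p.castSucc - l q + 1))
    (fun p => p.castSucc = i) (fun q => False)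
    (fun q => (s - l q) / (s - l q + θ - 1)) (fun p => 1) (by
      intro p q hpq
      have g := h.ul p q hpq
      have g' := h'.ul p q hpq
      by_cases hp : p.castSucc = i
      · rw [hp, hi] at g'
        simp only [hp, if_true, if_false, mul_one, hi, hs]
        refine gam_down' _ _ _ _ _ ?_ ?_ ?_ ?_ ?_ <;> first | linarith | skip
        congr 1 <;> ring
      · simp [hp, hne])
  have e5 : ∏ p, (s - l p) / (s - l p + θ - 1) =
      (∏ p : Fin n, if (p:ℕ) < (i:ℕ) then (s - l p) / (s - l p + θ - 1) else 1) *
      (∏ q : Fin n, ∏ p : Fin n, if p.castSucc = i then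
        (if p ≤ q then (s - l q) / (s - l q + θ - 1) else 1) else 1) := by
    rw [← prod_mul_distrib]
    refine prod_congr rfl fun q _ => ?_
    by_cases hq : (q:ℕ) < (i:ℕ)
    · rw [if_pos hq, prod_eq_one, mul_one]
      intro p _
      split_ifs with h1 h2
      · subst h1
        have h3 : (q:ℕ) < (p:ℕ) := hq
        exact absurd h2 (not_le.2 h3)
      all_goals rfl
    · have hin : (i:ℕ) < n := by omega
      obtain ⟨i', rfl⟩ : ∃ i' : Fin n, i = i'.castSucc := ⟨⟨i, hin⟩, rfl⟩
      have : i' ≤ q := by simpa using hq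
      rw [if_neg hq]
      simp [this]
  unfold KR
  rw [e1, e3, e4, e5]
  simp only [prod_ite_eq', mem_univ, if_true, if_false, prod_const_one, one_mul, mul_one]
  ring

lemma gap_of {θ : ℝ} (hθ : 0 < θ) {n : ℕ} {U : Fin (n + 1) → ℕ} {L : Fin n → ℕ}
    (hU : Antitone U) (hL : Antitone L)
    (hI : ∀ i : Fin n, L i ≤ U i.castSucc ∧ U i.succ ≤ L i) : Gap θ (ell θ U) (ell θ L) := by
  have key : ∀ (a b : ℕ) (x y : ℕ) (e : ℕ), y ≤ x → a + e ≤ b →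
      (e : ℝ) * θ ≤ ((x:ℝ) - ((a:ℝ) + 1) * θ) - ((y:ℝ) - ((b:ℝ) + 1) * θ) := by
    intro a b x y e h1 h2
    have h1' : (y:ℝ) ≤ x := by exact_mod_cast h1
    have h2' : (a:ℝ) + e ≤ b := by exact_mod_cast h2
    nlinarith
  unfold ell
  constructor
  · intro p q hpq
    simpa using key p q (U p) (U q) 1 (hU hpq.le) hpq
  · intro p q hpq
    simpa using key p q (L p) (L q) 1 (hL hpq.le) hpq
  · intro p q hpq
    have : U q ≤ L p := (hU (a := p.succ) (b := q) (by simpa [Fin.le_def] using hpq)).trans (hI p).2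
    simpa using key p q (L p) (U q) 1 this hpq
  · intro p q hpq
    have : L q ≤ U p.castSucc := (hL hpq).trans (hI p).1
    simpa using key p q (U p.castSucc) (L q) 0 this (by simpa using hpq)

lemma vgap {θ : ℝ} (hθ : 0 < θ) {M c d : ℕ}
    {A : ∀ r : Fin (d + 1), Fin (c + 1 + (r : ℕ)) → ℕ} (hA : ValidConfig M c d A) (j : Fin d) :
    Gap (n := c + 1 + (j:ℕ)) θ (ell θ (n := c + 1 + (j:ℕ) + 1) (A j.succ)) (ell θ (A j.castSucc)) :=
  gap_of hθ (hA.1 j.succ) (hA.1 j.castSucc) (hA.2.2 j)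

lemma same_gap {θ : ℝ} (hθ : 0 < θ) {n : ℕ} {lam : Fin n → ℕ} (h : Antitone lam)
    (p q : Fin n) (hpq : p < q) : θ ≤ ell θ lam p - ell θ lam q := by
  have h1 : ((lam q : ℕ) : ℝ) ≤ lam p := by exact_mod_cast h hpq.le
  have h2 : ((p : ℕ) : ℝ) + 1 ≤ (q : ℕ) := by exact_mod_cast hpq
  unfold ell
  nlinarith

lemma Wtotal_ne {θ : ℝ} (hθ : 0 < θ) {M c d : ℕ} {w : ℕ → ℝ → ℂ} (hw : ∀ j x, w j x ≠ 0)
    {A : ∀ r : Fin (d + 1), Fin (c + 1 + (r : ℕ)) → ℕ} (hA : ValidConfig M c d A) :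
    Wtotal θ w c d A ≠ 0 := by
  unfold Wtotal
  refine mul_ne_zero (mul_ne_zero ?_ ?_) ?_
  · unfold HtC
    refine mul_ne_zero ?_ (prod_ne_zero_iff.2 fun p _ => hw _ _)
    rw [Complex.ofReal_ne_zero]
    refine (prod_pos fun p _ => prod_pos fun q hq => ?_).ne'
    simp only [mem_filter, mem_univ, true_and] at hq
    have := same_gap hθ (hA.1 ⟨d, Nat.lt_succ_self d⟩) p q hq
    exact div_pos (Real.Gamma_pos_of_pos (by linarith)) (Real.Gamma_pos_of_pos (by linarith))
  · unfold HbC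
    rw [Complex.ofReal_ne_zero]
    refine (prod_pos fun p _ => prod_pos fun q hq => ?_).ne'
    simp only [mem_filter, mem_univ, true_and] at hq
    have := same_gap hθ (hA.1 ⟨0, Nat.succ_pos d⟩) p q hq
    exact div_pos (Real.Gamma_pos_of_pos (by linarith)) (Real.Gamma_pos_of_pos (by linarith))
  · refine prod_ne_zero_iff.2 fun j _ => ?_
    rw [IkernelC_eq]
    refine mul_ne_zero ?_ (prod_ne_zero_iff.2 fun p _ => hw _ _)
    rw [Complex.ofReal_ne_zero]
    exact (KR_pos hθ (vgap hθ hA j)).ne'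

lemma row_ne {θ : ℝ} (hθ : 0 < θ) {n : ℕ} {lam lam' : Fin n → ℕ} (h : Antitone lam)
    (h' : Antitone lam') (i p : Fin n) (hp : p ≠ i) (s : ℝ) (hs : ell θ lam i = s)
    (hs' : ell θ lam' i = s - 1) (he : lam' p = lam p) :
    s - ell θ lam p ≠ 0 ∧ s - ell θ lam p + θ - 1 ≠ 0 ∧ s - ell θ lam p - 1 ≠ 0 ∧
      s - ell θ lam p - θ ≠ 0 := by
  have he' : ell θ lam' p = ell θ lam p := by simp [ell, he]
  rcases lt_or_gt_of_ne hp with hlt | hgt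
  · have g := same_gap hθ h p i hlt
    rw [hs] at g
    refine ⟨?_, ?_, ?_, ?_⟩ <;> apply ne_of_lt <;> linarith
  · have g := same_gap hθ h' i p hgt
    rw [hs', he'] at g
    refine ⟨?_, ?_, ?_, ?_⟩ <;> apply ne_of_gt <;> linarith

lemma prod_split_lt {n : ℕ} (i : Fin n) (i0 : ℕ) (hi : (i : ℕ) = i0) (f : Fin n → ℝ) :
    (∏ q, if i < q then f q else 1) * (∏ q, if q < i then f q else 1) =
      ∏ q ∈ univ.filter (fun q : Fin n => (q : ℕ) ≠ i0), f q := by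
  rw [← prod_mul_distrib, prod_filter]
  refine prod_congr rfl fun q _ => ?_
  subst hi
  rcases lt_trichotomy i q with h | h | h
  · simp [h, not_lt.2 h.le, Fin.val_inj, h.ne']
  · simp [h]
  · simp [h, not_lt.2 h.le, Fin.val_inj, h.ne]

lemma prod_cancel {n : ℕ} (i : Fin n) (i0 : ℕ) (hi : (i : ℕ) = i0) (f g : Fin n → ℝ)
    (h : ∀ p, p ≠ i → f p * g p = 1) :
    (∏ q ∈ univ.filter (fun q : Fin n => (q : ℕ) ≠ i0), f q) * ∏ q, g q = g i := by
  subst hi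
  rw [prod_filter, ← prod_mul_distrib, prod_eq_single i]
  · simp
  · intro p _ hp
    rw [if_pos (by simpa [Fin.val_inj] using hp), h p hp]
  · simp

lemma single {θ : ℝ} (hθ : 0 < θ) {M c d : ℕ} {w : ℕ → ℝ → ℂ} (hw : ∀ j x, w j x ≠ 0)
    {A A' : ∀ r : Fin (d + 1), Fin (c + 1 + (r : ℕ)) → ℕ} (hA : ValidConfig M c d A)
    (hA' : ValidConfig M c d A') (t i0 : ℕ) (ht : t + 2 ≤ d) (hi0 : i0 < c + 1 + (t + 1)) (s : ℝ)
    (hs : ell θ (A ⟨t + 1, by omega⟩) ⟨i0, hi0⟩ = s)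
    (hi : ell θ (A' ⟨t + 1, by omega⟩) ⟨i0, hi0⟩ = s - 1)
    (hrow : ∀ r : Fin (d + 1), (r : ℕ) ≠ t + 1 → A' r = A r)
    (hne : ∀ p : Fin (c + 1 + (t + 1)), p ≠ ⟨i0, hi0⟩ →
      A' ⟨t + 1, by omega⟩ p = A ⟨t + 1, by omega⟩ p) :
    Wtotal θ w c d A' = Wtotal θ w c d A *
      ((w (c + 1 + (t + 1)) (s - 1) / w (c + 1 + (t + 1)) s) *
        Complex.ofReal
          ((∏ p ∈ (Finset.univ : Finset (Fin (c + 1 + (t + 1)))).filter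
                (fun p : Fin (c + 1 + (t + 1)) => (p : ℕ) ≠ i0),
              (s - ell θ (A ⟨t + 1, by omega⟩) p + θ - 1) /
                (s - ell θ (A ⟨t + 1, by omega⟩) p)) *
            (∏ p ∈ (Finset.univ : Finset (Fin (c + 1 + (t + 1)))).filter
                (fun p : Fin (c + 1 + (t + 1)) => (p : ℕ) ≠ i0),
              (s - ell θ (A ⟨t + 1, by omega⟩) p - 1) /
                (s - ell θ (A ⟨t + 1, by omega⟩) p - θ)) *
            (∏ p : Fin (c + 1 + t),
              (s - ell θ (A ⟨t, by omega⟩) p) /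
                (s - ell θ (A ⟨t, by omega⟩) p + θ - 1)) *
            ∏ p : Fin (c + 1 + (t + 2)),
              (s - ell θ (A ⟨t + 2, by omega⟩) p - θ) /
                (s - ell θ (A ⟨t + 2, by omega⟩) p - 1))) := by
  set x : Fin (c + 1 + (t + 1)) → ℝ := ell θ (A ⟨t + 1, by omega⟩) with hx
  set x' : Fin (c + 1 + (t + 1)) → ℝ := ell θ (A' ⟨t + 1, by omega⟩) with hx'
  set y : Fin (c + 1 + t) → ℝ := ell θ (A ⟨t, by omega⟩) with hy
  set z : Fin (c + 1 + (t + 2)) → ℝ := ell θ (A ⟨t + 2, by omega⟩) with hz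
  set i : Fin (c + 1 + (t + 1)) := ⟨i0, hi0⟩ with hidef
  have hxne : ∀ p, p ≠ i → x' p = x p := by
    intro p hp
    simp only [hx, hx', ell, hne p hp]
  have rt : A' ⟨t, by omega⟩ = A ⟨t, by omega⟩ := hrow _ (by simp)
  have rt2 : A' ⟨t + 2, by omega⟩ = A ⟨t + 2, by omega⟩ := hrow _ (by simp)
  have g1 : Gap (n := c + 1 + t) θ x y := vgap hθ hA ⟨t, by omega⟩
  have g2 : Gap (n := c + 1 + (t + 1)) θ z x := vgap hθ hA ⟨t + 1, by omega⟩
  have g1' : Gap (n := c + 1 + t) θ x' y := by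
    have := vgap hθ hA' ⟨t, by omega⟩
    rw [hy, ← rt]; exact this
  have g2' : Gap (n := c + 1 + (t + 1)) θ z x' := by
    have := vgap hθ hA' ⟨t + 1, by omega⟩
    rw [hz, ← rt2]; exact this
  have kU := KR_upper hθ g1 g1' i s hs hi hxne
  have kL := KR_lower hθ g2 g2' i s hs hi hxne
  have hwt : ∏ p, w (c + 1 + (t + 1)) (x' p) =
      (∏ p, w (c + 1 + (t + 1)) (x p)) * (w (c + 1 + (t + 1)) (s - 1) / w (c + 1 + (t + 1)) s) := by
    rw [← mul_prod_erase univ _ (mem_univ i), ← mul_prod_erase univ (fun p => w _ (x p)) (mem_univ i),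
      hi, hs]
    rw [prod_congr rfl (fun p hp => by rw [hxne p (ne_of_mem_erase hp)])]
    have := hw (c + 1 + (t + 1)) s
    field_simp
  set ρ1 : ℝ := ((∏ q, if i < q then (s - x q - 1) / (s - x q - θ) else 1) *
        (∏ p, if p < i then (s - x p + θ - 1) / (s - x p) else 1)) *
        ∏ p, (s - y p) / (s - y p + θ - 1) with hρ1
  set ρ2 : ℝ := ((∏ q, if i < q then (s - x q + θ - 1) / (s - x q) else 1) *
        (∏ p, if p < i then (s - x p - 1) / (s - x p - θ) else 1)) *
        ∏ p, (s - z p - θ) / (s - z p - 1) with hρ2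
  set W0 : ℂ := w (c + 1 + (t + 1)) (s - 1) / w (c + 1 + (t + 1)) s with hW0
  have hk : ∀ j : Fin d, IkernelC θ (w (c + 1 + (j : ℕ))) (A' j.succ) (A' j.castSucc) =
      IkernelC θ (w (c + 1 + (j : ℕ))) (A j.succ) (A j.castSucc) *
       ((if j = ⟨t, by omega⟩ then (ρ1 : ℂ) else 1) *
        (if j = ⟨t + 1, by omega⟩ then W0 * (ρ2 : ℂ) else 1)) := by
    intro j
    by_cases h1 : j = ⟨t, by omega⟩
    · have h2 : ¬ (j = ⟨t + 1, by omega⟩) := by rw [h1]; simp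
      rw [if_pos h1, if_neg h2, mul_one]
      subst h1
      have hc : A' (Fin.castSucc ⟨t, by omega⟩) = A (Fin.castSucc ⟨t, by omega⟩) := rt
      rw [hc, IkernelC_eq, IkernelC_eq]
      have : KR θ (n := c + 1 + t) (ell θ (n := c + 1 + t + 1) (A' (Fin.succ ⟨t, by omega⟩)))
        (ell θ (A (Fin.castSucc ⟨t, by omega⟩))) =
        KR θ (n := c + 1 + t) (ell θ (n := c + 1 + t + 1) (A (Fin.succ ⟨t, by omega⟩)))
        (ell θ (A (Fin.castSucc ⟨t, by omega⟩))) * ρ1 := kU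
      rw [this]
      push_cast
      ring
    · by_cases h2 : j = ⟨t + 1, by omega⟩
      · rw [if_neg h1, if_pos h2, one_mul]
        subst h2
        have hc : A' (Fin.succ ⟨t + 1, by omega⟩) = A (Fin.succ ⟨t + 1, by omega⟩) := rt2
        rw [hc, IkernelC_eq, IkernelC_eq]
        have : KR θ (n := c + 1 + (t + 1)) (ell θ (n := c + 1 + (t + 1) + 1) (A (Fin.succ ⟨t + 1, by omega⟩)))
          (ell θ (A' (Fin.castSucc ⟨t + 1, by omega⟩))) =
          KR θ (n := c + 1 + (t + 1)) (ell θ (n := c + 1 + (t + 1) + 1) (A (Fin.succ ⟨t + 1, by omega⟩)))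
          (ell θ (A (Fin.castSucc ⟨t + 1, by omega⟩))) * ρ2 := kL
        rw [this]
        have hwt' : ∏ p : Fin (c + 1 + (t + 1)), w (c + 1 + (t + 1))
            (ell θ (A' (Fin.castSucc ⟨t + 1, by omega⟩)) p) =
          (∏ p : Fin (c + 1 + (t + 1)), w (c + 1 + (t + 1))
            (ell θ (A (Fin.castSucc ⟨t + 1, by omega⟩)) p)) * W0 := hwt
        push_cast
        refine (congrArg _ hwt').trans ?_
        have alg : ∀ a b e f : ℂ, a * b * (e * f) = a * e * (f * b) := by intros; ring
        exact alg _ _ _ _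
      · rw [if_neg h1, if_neg h2, mul_one, mul_one]
        have e1 : A' j.succ = A j.succ := hrow _ (by
          simp [Fin.ext_iff] at h1 ⊢; exact h1)
        have e2 : A' j.castSucc = A j.castSucc := hrow _ (by
          simp [Fin.ext_iff] at h2 ⊢; exact h2)
        rw [e1, e2]
  have hd : A' ⟨d, Nat.lt_succ_self d⟩ = A ⟨d, Nat.lt_succ_self d⟩ := hrow _ (by simp; omega)
  have h0 : A' ⟨0, Nat.succ_pos d⟩ = A ⟨0, Nat.succ_pos d⟩ := hrow _ (by simp)
  unfold Wtotal
  rw [hd, h0, prod_congr rfl fun j _ => hk j, prod_mul_distrib, prod_mul_distrib,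
    prod_ite_eq', prod_ite_eq', if_pos (mem_univ _), if_pos (mem_univ _)]
  rw [← prod_split_lt i i0 rfl, ← prod_split_lt i i0 rfl, hρ1, hρ2]
  push_cast
  ring

lemma main_aux {θ : ℝ} (hθ : 0 < θ) {M c d : ℕ} {w : ℕ → ℝ → ℂ} (hw : ∀ j x, w j x ≠ 0)
    {A : ∀ r : Fin (d + 1), Fin (c + 1 + (r : ℕ)) → ℕ} (hA : ValidConfig M c d A)
    (t i0 : ℕ) (hi0 : i0 < c + 1 + (t + 1)) (s : ℝ) (m : ℕ)
    (Atil : ∀ r : Fin (d + 1), Fin (c + 1 + (r : ℕ)) → ℕ) (hA' : ValidConfig M c d Atil)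
    (hm : t + 1 + m + 1 ≤ d)
    (hs : ∀ r : Fin (d + 1), ∀ _h2 : t + 1 ≤ (r : ℕ), ∀ _h1 : (r : ℕ) ≤ t + 1 + m,
      ell θ (A r) ⟨i0, by omega⟩ = s)
    (hshift : ∀ (r : Fin (d + 1)) (p : Fin (c + 1 + (r : ℕ))),
      Atil r p =
        if t + 1 ≤ (r : ℕ) ∧ (r : ℕ) ≤ t + 1 + m ∧ (p : ℕ) = i0 then A r p - 1 else A r p)
    (hge1 : ∀ (r : Fin (d + 1)) (p : Fin (c + 1 + (r : ℕ))),
      t + 1 ≤ (r : ℕ) → (r : ℕ) ≤ t + 1 + m → (p : ℕ) = i0 → 1 ≤ A r p) :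
    Wtotal θ w c d Atil = Wtotal θ w c d A *
      ((∏ j ∈ Finset.Icc (c + 1 + (t + 1)) (c + 1 + (t + 1 + m)), w j (s - 1) / w j s) *
        Complex.ofReal
          ((∏ p ∈ (Finset.univ : Finset (Fin (c + 1 + (t + 1 + m)))).filter
                (fun p : Fin (c + 1 + (t + 1 + m)) => (p : ℕ) ≠ i0),
              (s - ell θ (A ⟨t + 1 + m, by omega⟩) p + θ - 1) /
                (s - ell θ (A ⟨t + 1 + m, by omega⟩) p)) *
            (∏ p ∈ (Finset.univ : Finset (Fin (c + 1 + (t + 1)))).filter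
                (fun p : Fin (c + 1 + (t + 1)) => (p : ℕ) ≠ i0),
              (s - ell θ (A ⟨t + 1, by omega⟩) p - 1) /
                (s - ell θ (A ⟨t + 1, by omega⟩) p - θ)) *
            (∏ p : Fin (c + 1 + t),
              (s - ell θ (A ⟨t, by omega⟩) p) /
                (s - ell θ (A ⟨t, by omega⟩) p + θ - 1)) *
            ∏ p : Fin (c + 1 + (t + 1 + m + 1)),
              (s - ell θ (A ⟨t + 1 + m + 1, by omega⟩) p - θ) /
                (s - ell θ (A ⟨t + 1 + m + 1, by omega⟩) p - 1))) := by
  have ell_shift : ∀ (r : Fin (d + 1)) (_ : t + 1 ≤ (r : ℕ)) (_ : (r : ℕ) ≤ t + 1 + m),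
      ell θ (Atil r) ⟨i0, by omega⟩ = s - 1 := by
    intro r h2 h1
    have h := hs r h2 h1
    have hg := hge1 r ⟨i0, by omega⟩ h2 h1 rfl
    have hh := hshift r ⟨i0, by omega⟩
    rw [if_pos ⟨h2, h1, rfl⟩] at hh
    unfold ell at h ⊢
    rw [hh, Nat.cast_sub hg, ← h]
    push_cast; ring
  induction m generalizing Atil with
  | zero =>
    have := single hθ hw hA hA' t i0 (by omega) hi0 s (hs ⟨t + 1, by omega⟩ le_rfl le_rfl)
      (ell_shift ⟨t + 1, by omega⟩ le_rfl le_rfl)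
      (by
        intro r hr
        funext p
        rw [hshift, if_neg (by omega)])
      (by
        intro p hp
        rw [hshift, if_neg]
        rintro ⟨_, _, h⟩
        exact hp (Fin.ext h))
    rw [this, show Finset.Icc (c + 1 + (t + 1)) (c + 1 + (t + 1 + 0)) = {c + 1 + (t + 1)} from
      Finset.Icc_self _, prod_singleton]
  | succ m ih =>
    set T := t + 1 + m with hT
    have hi0T : i0 < c + 1 + T := by omega
    have hi0T1 : i0 < c + 1 + (T + 1) := by omega
    let B : ∀ r : Fin (d + 1), Fin (c + 1 + (r : ℕ)) → ℕ := fun r p =>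
      if t + 1 ≤ (r : ℕ) ∧ (r : ℕ) ≤ T ∧ (p : ℕ) = i0 then A r p - 1 else A r p
    have hBt : ∀ r : Fin (d + 1), (r : ℕ) ≤ T → B r = Atil r := by
      intro r hr
      funext p
      rw [hshift]
      have : (r : ℕ) ≤ t + 1 + (m + 1) := by omega
      simp only [B, hr, this]
    have hBA : ∀ r : Fin (d + 1), T < (r : ℕ) → B r = A r := by
      intro r hr
      funext p
      simp only [B]
      rw [if_neg (by omega)]
    have hB : ValidConfig M c d B := by
      refine ⟨?_, ?_, ?_⟩
      · intro r
        rcases le_or_gt (r : ℕ) T with h | h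
        · rw [hBt r h]; exact hA'.1 r
        · rw [hBA r h]; exact hA.1 r
      · intro r
        rcases le_or_gt (r : ℕ) T with h | h
        · rw [hBt r h]; exact hA'.2.1 r
        · rw [hBA r h]; exact hA.2.1 r
      · intro r i
        rcases lt_trichotomy (r : ℕ) T with h | h | h
        · rw [hBt r.castSucc (by simp; omega), hBt r.succ (by simp; omega)]
          exact hA'.2.2 r i
        · rw [hBt r.castSucc (by simp; omega), hBA r.succ (by simp; omega)]
          have a := hA.2.2 r i
          have a' := hA'.2.2 r i
          have e1 := hshift r.castSucc i
          have e2 := hshift r.succ i.succ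
          by_cases hi : (i.succ : ℕ) = i0
          · rw [if_neg (by rintro ⟨_, _, h⟩; simp at hi; omega)] at e1
            rw [e1]; exact a
          · rw [if_neg (by rintro ⟨_, _, h⟩; exact hi h)] at e2
            rw [e2] at a'
            refine ⟨le_trans ?_ a.1, a'.2⟩
            rw [e1]; split_ifs <;> omega
        · rw [hBA r.castSucc (by simp; omega), hBA r.succ (by simp; omega)]
          exact hA.2.2 r i
    have IH := ih B hB (by omega) (fun r h2 h1 => hs r h2 (by omega)) (fun r p => rfl)
      (fun r p h2 h1 => hge1 r p h2 (by omega))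
      (fun r h2 h1 => by rw [hBt r h1]; exact ell_shift r h2 (by omega))
    have rB1 : B ⟨T + 1, by omega⟩ = A ⟨T + 1, by omega⟩ := hBA _ (by simp)
    have rB2 : B ⟨T + 2, by omega⟩ = A ⟨T + 2, by omega⟩ := hBA _ (by simp)
    have S := single hθ hw hB hA' T i0 (by omega) hi0T1 s
      (by rw [rB1]; exact hs ⟨T + 1, by omega⟩ (by simp; omega) (by simp; omega))
      (ell_shift ⟨T + 1, by omega⟩ (by simp; omega) (by simp; omega))
      (by
        intro r hr
        rcases le_or_gt (r : ℕ) T with h | h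
        · exact (hBt r h).symm
        · rw [hBA r h]
          funext p
          rw [hshift, if_neg (by omega)])
      (by
        intro p hp
        rw [rB1, hshift, if_neg]
        rintro ⟨_, _, h⟩
        exact hp (Fin.ext h))
    rw [rB1, rB2] at S
    rw [S, IH]
    have hIcc : ∏ j ∈ Finset.Icc (c + 1 + (t + 1)) (c + 1 + (t + 1 + (m + 1))), w j (s - 1) / w j s =
      (∏ j ∈ Finset.Icc (c + 1 + (t + 1)) (c + 1 + T), w j (s - 1) / w j s) *
        (w (c + 1 + (T + 1)) (s - 1) / w (c + 1 + (T + 1)) s) :=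
      Finset.prod_Icc_succ_top (a := c + 1 + (t + 1)) (b := c + 1 + T) (by omega) _
    rw [hIcc]
    -- cancellation in row T
    have C1 := prod_cancel (n := c + 1 + T) ⟨i0, hi0T⟩ i0 rfl
      (fun p => (s - ell θ (A ⟨T, by omega⟩) p + θ - 1) / (s - ell θ (A ⟨T, by omega⟩) p))
      (fun p => (s - ell θ (B ⟨T, by omega⟩) p) / (s - ell θ (B ⟨T, by omega⟩) p + θ - 1)) (by
        intro p hp
        have hb : B ⟨T, by omega⟩ p = A ⟨T, by omega⟩ p := by
          simp only [B]
          rw [if_neg]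
          rintro ⟨_, _, h⟩
          exact hp (Fin.ext h)
        have hb' : ell θ (B ⟨T, by omega⟩) p = ell θ (A ⟨T, by omega⟩) p := by
          simp only [ell, hb]
        obtain ⟨n1, n2, n3, n4⟩ := row_ne hθ (hA.1 ⟨T, by omega⟩) (hB.1 ⟨T, by omega⟩)
          ⟨i0, hi0T⟩ p hp s (hs ⟨T, by omega⟩ (by simp; omega) (by simp; omega))
          (by rw [hBt _ le_rfl]; exact ell_shift ⟨T, by omega⟩ (by simp; omega) (by simp; omega)) hb
        simp only [hb']
        field_simp)
    have C2 := prod_cancel (n := c + 1 + (T + 1)) ⟨i0, hi0T1⟩ i0 rfl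
      (fun p => (s - ell θ (A ⟨T + 1, by omega⟩) p - 1) / (s - ell θ (A ⟨T + 1, by omega⟩) p - θ))
      (fun p => (s - ell θ (A ⟨T + 1, by omega⟩) p - θ) / (s - ell θ (A ⟨T + 1, by omega⟩) p - 1)) (by
        intro p hp
        have hb : Atil ⟨T + 1, by omega⟩ p = A ⟨T + 1, by omega⟩ p := by
          rw [hshift, if_neg]
          rintro ⟨_, _, h⟩
          exact hp (Fin.ext h)
        obtain ⟨n1, n2, n3, n4⟩ := row_ne hθ (hA.1 ⟨T + 1, by omega⟩) (hA'.1 ⟨T + 1, by omega⟩)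
          ⟨i0, hi0T1⟩ p hp s (hs ⟨T + 1, by omega⟩ (by simp; omega) (by simp; omega))
          (ell_shift ⟨T + 1, by omega⟩ (by simp; omega) (by simp; omega)) hb
        field_simp)
    have v1 : ell θ (B ⟨T, by omega⟩) ⟨i0, hi0T⟩ = s - 1 := by
      rw [hBt _ le_rfl]; exact ell_shift ⟨T, by omega⟩ (by simp; omega) (by simp; omega)
    have v2 : ell θ (A ⟨T + 1, by omega⟩) ⟨i0, hi0T1⟩ = s :=
      hs ⟨T + 1, by omega⟩ (by simp; omega) (by simp; omega)
    simp only [v1] at C1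
    simp only [v2] at C2
    have alg : ∀ (W v1 v2 : ℂ) (a R2 L e g f a' U : ℝ),
        a * a' = (s - (s - 1)) / (s - (s - 1) + θ - 1) → f * e = (s - s - θ) / (s - s - 1) →
        W * (v1 * ((a * R2 * L * e : ℝ) : ℂ)) * (v2 * ((g * f * a' * U : ℝ) : ℂ)) =
        W * (v1 * v2 * ((g * R2 * L * U : ℝ) : ℂ)) := by
      intro W v1 v2 a R2 L e g f a' U h1 h2
      have : (a * R2 * L * e) * (g * f * a' * U) = g * R2 * L * U := by
        have h3 : (a * R2 * L * e) * (g * f * a' * U) = (a * a') * (f * e) * (g * R2 * L * U) := by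
          ring
        rw [h3, h1, h2]
        have : (s - (s - 1) + θ - 1) = θ := by ring
        rw [this]
        field_simp
        ring
      rw [← this]
      push_cast
      ring
    exact alg _ _ _ _ _ _ _ _ _ _ _ C1 C2

/-- Multi-level shift ratio (2.9)/(TR1): with `k = c+1`, `N = c+1+d`, `j₂ = c+1+r₂`,
`j₁ = c+1+r₁`, `k+1 ≤ j₂ ≤ j₁ ≤ N−1`, suppose `ℓ^{j}_i = s` for `j₂ ≤ j ≤ j₁` and
`ℓ̃` is obtained from `ℓ` by decreasing these coordinates by `1`, with both
configurations valid. Then, for the measure `ℙ^{θ,M}_{N,k} = Z⁻¹·W`,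
`ℙ(ℓ̃)/ℙ(ℓ) = ∏_{j=j₂}^{j₁} w_j(s−1)/w_j(s) · ∏_{p≠i,p≤j₁}(s−ℓ^{j₁}_p+θ−1)/(s−ℓ^{j₁}_p)
· ∏_{p≠i,p≤j₂}(s−ℓ^{j₂}_p−1)/(s−ℓ^{j₂}_p−θ) · ∏_{p≤j₂−1}(s−ℓ^{j₂−1}_p)/(s−ℓ^{j₂−1}_p+θ−1)
· ∏_{p≤j₁+1}(s−ℓ^{j₁+1}_p−θ)/(s−ℓ^{j₁+1}_p−1)`. -/
theorem multilevel_shift_ratio (θ : ℝ) (hθ : 0 < θ) (M c d : ℕ)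
    (w : ℕ → ℝ → ℂ) (hw : ∀ j x, w j x ≠ 0) (Z : ℂ) (hZ : Z ≠ 0)
    (A Atil : ∀ r : Fin (d + 1), Fin (c + 1 + (r : ℕ)) → ℕ)
    (hA : ValidConfig M c d A) (hA' : ValidConfig M c d Atil)
    (r₁ r₂ i0 : ℕ) (hr2 : 1 ≤ r₂) (hr12 : r₂ ≤ r₁) (hr1 : r₁ + 1 ≤ d)
    (hi0 : i0 < c + 1 + r₂) (s : ℝ)
    (hs : ∀ r : Fin (d + 1), ∀ _h2 : r₂ ≤ (r : ℕ), ∀ _h1 : (r : ℕ) ≤ r₁,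
      ell θ (A r) ⟨i0, by omega⟩ = s)
    (hshift : ∀ (r : Fin (d + 1)) (p : Fin (c + 1 + (r : ℕ))),
      Atil r p =
        if r₂ ≤ (r : ℕ) ∧ (r : ℕ) ≤ r₁ ∧ (p : ℕ) = i0 then A r p - 1 else A r p)
    (hge1 : ∀ (r : Fin (d + 1)) (p : Fin (c + 1 + (r : ℕ))),
      r₂ ≤ (r : ℕ) → (r : ℕ) ≤ r₁ → (p : ℕ) = i0 → 1 ≤ A r p) :
    (Wtotal θ w c d Atil / Z) / (Wtotal θ w c d A / Z) =
      (∏ j ∈ Finset.Icc (c + 1 + r₂) (c + 1 + r₁), w j (s - 1) / w j s) *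
        Complex.ofReal
          ((∏ p ∈ (Finset.univ : Finset (Fin (c + 1 + r₁))).filter
                (fun p : Fin (c + 1 + r₁) => (p : ℕ) ≠ i0),
              (s - ell θ (A ⟨r₁, by omega⟩) p + θ - 1) /
                (s - ell θ (A ⟨r₁, by omega⟩) p)) *
            (∏ p ∈ (Finset.univ : Finset (Fin (c + 1 + r₂))).filter
                (fun p : Fin (c + 1 + r₂) => (p : ℕ) ≠ i0),
              (s - ell θ (A ⟨r₂, by omega⟩) p - 1) /
                (s - ell θ (A ⟨r₂, by omega⟩) p - θ)) *
            (∏ p : Fin (c + 1 + (r₂ - 1)),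
              (s - ell θ (A ⟨r₂ - 1, by omega⟩) p) /
                (s - ell θ (A ⟨r₂ - 1, by omega⟩) p + θ - 1)) *
            ∏ p : Fin (c + 1 + (r₁ + 1)),
              (s - ell θ (A ⟨r₁ + 1, by omega⟩) p - θ) /
                (s - ell θ (A ⟨r₁ + 1, by omega⟩) p - 1)) := by
  obtain ⟨t, rfl⟩ : ∃ t, r₂ = t + 1 := ⟨r₂ - 1, by omega⟩
  obtain ⟨m, rfl⟩ := Nat.exists_eq_add_of_le hr12
  have key := main_aux hθ hw hA t i0 hi0 s m Atil hA' hr1 hs hshift hge1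
  have hW := Wtotal_ne hθ hw hA
  rw [div_div_div_cancel_right₀ hZ, key, mul_div_cancel_left₀ _ hW]
  rfl

end
end
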